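/- arXiv:2202.03100 — 2 statements merged into one kernel-verified Lean document; each statement's English description precedes it below -/
import Mathlib

section
/- Let 𝒲, 𝒳, 𝒴, 𝓑 be finite sets with |𝓑| ≥ 2, P_W a distribution on 𝒲, and π_{XY} a distribution on 𝒳×𝒴 such that there exists y ∈ 𝒴 with π_{Y|X}(y|x) > 0 for every x with π_X(x) > 0. Then for every ε > 0 there exist n ≥ 1 and a sequential code {(P_{B_k|W^k X^k B^{k-1}}, P_{Y_k|W^k B^k Y^{k-1}})}_{k=1}^n such that the induced channel satisfies (1/n) D(P_{Y^n|X^n} ‖ π_{Y|X}^n | π_X^n) ≤ Δ(π_{XY}, P_W) + ε, where Δ(π_{XY}, P_W) is the minimum, over finite auxiliary alphabets 𝒰, 𝒱 and distributions P_{UV}, P_{B|XUV}, P_{Y|BUV} satisfying H(U|V) ≤ H(BU|XYV) + H(W), of D(P_{Y|XV} ‖ π_{Y|X} | π_X P_V), with entropies evaluated under π_X P_{UV} P_{B|XUV} P_{Y|BUV}. -/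
open scoped BigOperators ENNReal
open Classical

noncomputable section

/-- `p` is a probability mass function on the finite type `α`. -/
def IsDist {α : Type} [Fintype α] (p : α → ℝ) : Prop :=
  (∀ a, 0 ≤ p a) ∧ (∑ a, p a) = 1

/-- `k` is a conditional probability kernel. -/
def IsKernel {α β : Type} [Fintype β] (k : α → β → ℝ) : Prop :=
  ∀ a, (∀ b, 0 ≤ k a b) ∧ (∑ b, k a b) = 1

/-- Marginal (pushforward) of `p` along the map `f`. -/
def marg {α β : Type} [Fintype α] (f : α → β) (p : α → ℝ) : β → ℝ :=
  fun b => ∑ a, if f a = b then p a else 0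

/-- Shannon entropy (natural log). -/
def ent {α : Type} [Fintype α] (p : α → ℝ) : ℝ :=
  ∑ a, Real.negMulLog (p a)

/-- Conditional entropy `H(f(A) | g(A))` for `A ∼ p`. -/
def condEnt {α β γ : Type} [Fintype α] [Fintype β] [Fintype γ]
    (f : α → β) (g : α → γ) (p : α → ℝ) : ℝ :=
  ent (marg (fun a => (f a, g a)) p) - ent (marg g p)

/-- Kullback–Leibler divergence `D(p‖q)` with value `⊤` if `p` is not absolutely
continuous with respect to `q`. -/
def KL {α : Type} [Fintype α] (p q : α → ℝ) : ℝ≥0∞ :=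
  if ∀ a, q a = 0 → p a = 0 then ENNReal.ofReal (∑ a, p a * Real.log (p a / q a)) else ⊤

/-- The joint distribution `π_X P_{UV} P_{B|XUV} P_{Y|BUV}` on `X × U × V × B × Y`. -/
def seqJoint {X Y B U V : Type} (πX : X → ℝ) (PUV : U × V → ℝ)
    (PB : X × U × V → B → ℝ) (PY : B × U × V → Y → ℝ) : X × U × V × B × Y → ℝ :=
  fun q => πX q.1 * PUV (q.2.1, q.2.2.1) * PB (q.1, q.2.1, q.2.2.1) q.2.2.2.1 *
    PY (q.2.2.2.1, q.2.1, q.2.2.1) q.2.2.2.2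

/-- The set of values `D(P_{Y|XV} ‖ π_{Y|X} | π_X P_V)` over all feasible tuples
`(𝒰, 𝒱, P_{UV}, P_{B|XUV}, P_{Y|BUV})` with `H(U|V) ≤ H(BU|XYV) + t`. -/
def psiSet (X Y B : Type) [Fintype X] [Fintype Y] [Fintype B] (π : X × Y → ℝ) (t : ℝ) :
    Set ℝ≥0∞ :=
  { d | ∃ (m l : ℕ) (PUV : Fin m × Fin l → ℝ)
      (PB : X × Fin m × Fin l → B → ℝ) (PY : B × Fin m × Fin l → Y → ℝ),
      IsDist PUV ∧ IsKernel PB ∧ IsKernel PY ∧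
      condEnt (fun q : X × Fin m × Fin l × B × Y => q.2.1)
          (fun q => q.2.2.1) (seqJoint (marg Prod.fst π) PUV PB PY) ≤
        condEnt (fun q : X × Fin m × Fin l × B × Y => (q.2.2.2.1, q.2.1))
          (fun q => (q.1, q.2.2.2.2, q.2.2.1)) (seqJoint (marg Prod.fst π) PUV PB PY) + t ∧
      d = KL (marg (fun q : X × Fin m × Fin l × B × Y => (q.1, q.2.2.1, q.2.2.2.2))
              (seqJoint (marg Prod.fst π) PUV PB PY))
            (fun r : X × Fin l × Y => marg Prod.snd PUV r.2.1 * π (r.1, r.2.2)) }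

/-- `Ψ(t)`, with the convention `Ψ(t) = ⊤` when there is no feasible tuple. -/
def Psi (X Y B : Type) [Fintype X] [Fintype Y] [Fintype B] (π : X × Y → ℝ) (t : ℝ) : ℝ≥0∞ :=
  sInf (psiSet X Y B π t)

/-- A sequential code of blocklength `n`: at epoch `k`, the encoder produces
`B_k` from `(W^k, X^k, B^{k-1})` and the decoder produces `Y_k` from
`(W^k, B^k, Y^{k-1})`.  Kernels are given on full histories together with
causality (prefix-dependence) conditions. -/
structure SeqCode (W X Y B : Type) [Fintype W] [Fintype X] [Fintype Y] [Fintype B]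
    (n : ℕ) where
  enc : Fin n → (Fin n → W) → (Fin n → X) → (Fin n → B) → B → ℝ
  dec : Fin n → (Fin n → W) → (Fin n → B) → (Fin n → Y) → Y → ℝ
  enc_dist : ∀ k w x b, IsDist (enc k w x b)
  dec_dist : ∀ k w b y, IsDist (dec k w b y)
  enc_causal : ∀ k w w' x x' b b',
    (∀ i, i ≤ k → w i = w' i) → (∀ i, i ≤ k → x i = x' i) → (∀ i, i < k → b i = b' i) →
    enc k w x b = enc k w' x' b'
  dec_causal : ∀ k w w' b b' y y',
    (∀ i, i ≤ k → w i = w' i) → (∀ i, i ≤ k → b i = b' i) → (∀ i, i < k → y i = y' i) →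
    dec k w b y = dec k w' b' y'

/-- The channel `P_{Y^n|X^n}` synthesized by a sequential code, with common
randomness `W_i` i.i.d. `∼ P_W`. -/
def SeqCode.channel {W X Y B : Type} [Fintype W] [Fintype X] [Fintype Y] [Fintype B]
    {n : ℕ} (C : SeqCode W X Y B n) (PW : W → ℝ) (x : Fin n → X) (y : Fin n → Y) : ℝ :=
  ∑ w : Fin n → W, ∑ b : Fin n → B,
    (∏ k, PW (w k)) * (∏ k, C.enc k w x b (b k)) * (∏ k, C.dec k w b y (y k))

/-- `Γ^{(n)}(π_{XY}, P_W)`: the least value of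
`D(P_{Y^n|X^n} ‖ π_{Y|X}^n | π_X^n)` over sequential codes of blocklength `n`. -/
def GammaN (W X Y B : Type) [Fintype W] [Fintype X] [Fintype Y] [Fintype B]
    (PW : W → ℝ) (π : X × Y → ℝ) (n : ℕ) : ℝ≥0∞ :=
  sInf { d | ∃ C : SeqCode W X Y B n,
    d = KL
      (fun p : (Fin n → X) × (Fin n → Y) =>
        (∏ i, marg Prod.fst π (p.1 i)) * C.channel PW p.1 p.2)
      (fun p : (Fin n → X) × (Fin n → Y) => ∏ i, π (p.1 i, p.2 i)) }

lemma prod_sum_univ {ι α : Type} [Fintype ι] [DecidableEq ι] [Fintype α] (f : ι → α → ℝ) :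
    ∏ i, ∑ a, f i a = ∑ a : ι → α, ∏ i, f i (a i) := by
  rw [Finset.prod_univ_sum, Fintype.piFinset_univ]

lemma IsDist.le_one {α : Type} [Fintype α] {p : α → ℝ} (hp : IsDist p) (a : α) : p a ≤ 1 := by
  rw [← hp.2]
  exact Finset.single_le_sum (fun i _ => hp.1 i) (Finset.mem_univ a)

lemma IsDist.pi {ι α : Type} [Fintype ι] [DecidableEq ι] [Fintype α] {p : ι → α → ℝ}
    (hp : ∀ i, IsDist (p i)) : IsDist (fun a : ι → α => ∏ i, p i (a i)) :=
  ⟨fun a => Finset.prod_nonneg fun i _ => (hp i).1 _, by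
    rw [← prod_sum_univ]; exact Finset.prod_eq_one fun i _ => (hp i).2⟩

/-- Expectation of a function of one coordinate under a product distribution. -/
lemma sum_pi_mul_apply {ι α : Type} [Fintype ι] [DecidableEq ι] [Fintype α] {p : ι → α → ℝ}
    (hp : ∀ i, IsDist (p i)) (j : ι) (f : α → ℝ) :
    ∑ a : ι → α, (∏ i, p i (a i)) * f (a j) = ∑ s, p j s * f s := by
  have h : ∀ a : ι → α, (∏ i, p i (a i)) * f (a j) =
      ∏ i, p i (a i) * (if i = j then f (a i) else 1) := by
    intro a
    rw [Finset.prod_mul_distrib, Finset.prod_ite_eq' Finset.univ j (fun i => f (a i))]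
    simp
  simp_rw [h]
  rw [← prod_sum_univ (fun i s => p i s * (if i = j then f s else 1)),
    Fintype.prod_eq_single j]
  · simp
  · intro i hi
    simp [hi, (hp i).2]

/-- Distinct coordinates are uncorrelated under a product distribution. -/
lemma sum_pi_mul_apply_mul_apply_eq_zero {ι α : Type} [Fintype ι] [DecidableEq ι] [Fintype α]
    {p : ι → α → ℝ} {j k : ι} (hjk : j ≠ k) (f g : α → ℝ)
    (hf : ∑ s, p j s * f s = 0) :
    ∑ a : ι → α, (∏ i, p i (a i)) * (f (a j) * g (a k)) = 0 := by
  have h : ∀ a : ι → α, (∏ i, p i (a i)) * (f (a j) * g (a k)) =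
      ∏ i, p i (a i) * (if i = j then f (a i) else 1) * (if i = k then g (a i) else 1) := by
    intro a
    rw [Finset.prod_mul_distrib, Finset.prod_mul_distrib,
      Finset.prod_ite_eq' Finset.univ j (fun i => f (a i)),
      Finset.prod_ite_eq' Finset.univ k (fun i => g (a i))]
    simp [mul_assoc]
  simp_rw [h]
  rw [← prod_sum_univ
    (fun i s => p i s * (if i = j then f s else 1) * (if i = k then g s else 1))]
  refine Finset.prod_eq_zero (Finset.mem_univ j) ?_
  simpa [hjk] using hf

/-- Mean absolute value of a linear combination of centred i.i.d. variables. -/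
lemma sum_pi_abs_le_sqrt {R S : Type} [Fintype R] [Fintype S] {p : S → ℝ} (hp : IsDist p)
    (c : R → ℝ) (f : S → ℝ) (hf : ∑ s, p s * f s = 0) :
    ∑ g : R → S, (∏ r, p (g r)) * |∑ r, c r * f (g r)| ≤
      √((∑ r, c r ^ 2) * ∑ s, p s * f s ^ 2) := by
  have hw := IsDist.pi (ι := R) (fun _ => hp)
  apply Real.le_sqrt_of_sq_le
  have h1 := Finset.sum_sq_le_sum_mul_sum_of_sq_le_mul Finset.univ
    (r := fun g : R → S => (∏ r, p (g r)) * |∑ r, c r * f (g r)|)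
    (f := fun g => ∏ r, p (g r))
    (g := fun g => (∏ r, p (g r)) * (∑ r, c r * f (g r)) ^ 2)
    (fun g _ => hw.1 g) (fun g _ => mul_nonneg (hw.1 g) (sq_nonneg _))
    (fun g _ => le_of_eq (by rw [mul_pow, sq_abs]; ring))
  rw [hw.2, one_mul] at h1
  refine h1.trans (le_of_eq ?_)
  calc ∑ g : R → S, (∏ r, p (g r)) * (∑ r, c r * f (g r)) ^ 2
      = ∑ g : R → S, ∑ r, ∑ r', c r * c r' * ((∏ r, p (g r)) * (f (g r) * f (g r'))) := by
        refine Finset.sum_congr rfl fun g _ => ?_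
        rw [sq, Finset.sum_mul_sum, Finset.mul_sum]
        refine Finset.sum_congr rfl fun r _ => ?_
        rw [Finset.mul_sum]
        exact Finset.sum_congr rfl fun r' _ => by ring
    _ = ∑ r, ∑ r', c r * c r' * ∑ g : R → S, ((∏ r, p (g r)) * (f (g r) * f (g r'))) := by
        rw [Finset.sum_comm]
        refine Finset.sum_congr rfl fun r _ => ?_
        rw [Finset.sum_comm]
        exact Finset.sum_congr rfl fun r' _ => by rw [Finset.mul_sum]
    _ = ∑ r, c r ^ 2 * ∑ s, p s * f s ^ 2 := by
        refine Finset.sum_congr rfl fun r _ => ?_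
        rw [Finset.sum_eq_single r]
        · rw [← sum_pi_mul_apply (fun _ : R => hp) r (fun s => f s ^ 2), sq]
          simp only [sq]
        · intro r' _ hr
          rw [sum_pi_mul_apply_mul_apply_eq_zero (p := fun _ : R => p) hr.symm f f hf, mul_zero]
        · simp
    _ = _ := by rw [Finset.sum_mul]

/-- One-point estimate for random hashing with i.i.d. values of law `p`. -/
lemma sum_pi_abs_hash_sub_le {R S : Type} [Fintype R] [Fintype S] {p : S → ℝ} (hp : IsDist p)
    {a : R → ℝ} (ha : ∀ r, 0 ≤ a r) {t θ : ℝ} (ht : 0 ≤ t) (hθ : 0 < θ) (s : S) :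
    ∑ g : R → S, (∏ r, p (g r)) * |∑ r, (if g r = s then a r else 0) - (∑ r, a r) * p s| ≤
      √θ * ((∑ r, a r) * p s) +
        2 * θ ^ (-t) * ((∑ r, a r * (a r / ∑ r', a r') ^ t) * (p s * p s ^ (-t))) := by
  set q := ∑ r, a r with hq
  have hq0 : 0 ≤ q := Finset.sum_nonneg fun r _ => ha r
  have hw := IsDist.pi (ι := R) (fun _ => hp)
  set f : S → ℝ := fun s' => (if s' = s then 1 else 0) - p s with hf
  have hps := hp.1 s
  have hps1 := hp.le_one s
  have hf0 : ∑ s', p s' * f s' = 0 := by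
    simp [hf, mul_sub, ← Finset.sum_mul, hp.2]
  have hf2 : ∑ s', p s' * f s' ^ 2 ≤ p s := by
    have : ∀ s', p s' * f s' ^ 2 = (if s' = s then p s' * (1 - 2 * p s) else 0) + p s' * p s ^ 2 := by
      intro s'
      by_cases h : s' = s
      · simp [hf, h]; ring
      · simp [hf, h]
    simp_rw [this]
    rw [Finset.sum_add_distrib, ← Finset.sum_mul, hp.2]
    simp
    nlinarith
  obtain ⟨good, hgood⟩ : ∃ good : R → Prop, ∀ r, good r ↔ a r ≤ θ * (q * p s) :=
    ⟨_, fun _ => Iff.rfl⟩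
  have hsplit : ∀ g : R → S, ∑ r, (if g r = s then a r else 0) - q * p s =
      ∑ r, (if good r then a r else 0) * f (g r) + ∑ r, (if good r then 0 else a r) * f (g r) := by
    intro g
    rw [← Finset.sum_add_distrib, hq, Finset.sum_mul, ← Finset.sum_sub_distrib]
    refine Finset.sum_congr rfl fun r _ => ?_
    by_cases h1 : good r <;> by_cases h2 : g r = s <;> simp [hf, h1, h2] <;> ring
  have hA : ∑ g : R → S, (∏ r, p (g r)) * |∑ r, (if good r then a r else 0) * f (g r)| ≤
      √θ * (q * p s) := by
    refine (sum_pi_abs_le_sqrt hp _ f hf0).trans ?_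
    rw [← Real.sqrt_sq (mul_nonneg hq0 hps), ← Real.sqrt_mul hθ.le]
    apply Real.sqrt_le_sqrt
    have h1 : ∑ r, (if good r then a r else 0) ^ 2 ≤ θ * (q * p s) * q := by
      rw [hq, Finset.mul_sum, ← hq]
      refine Finset.sum_le_sum fun r _ => ?_
      by_cases h1 : good r
      · simp only [h1, if_true, sq]
        exact mul_le_mul_of_nonneg_right ((hgood r).1 h1) (ha r)
      · have := ha r
        have h2 : 0 ≤ θ * (q * p s) * a r := by positivity
        simpa [h1] using h2
    calc _ ≤ (θ * (q * p s) * q) * p s :=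
          mul_le_mul h1 hf2 (Finset.sum_nonneg fun s' _ => mul_nonneg (hp.1 s') (sq_nonneg _))
            (by positivity)
      _ = _ := by ring
  have habs : ∑ s', p s' * |f s'| ≤ 2 * p s := by
    have : ∀ s', p s' * |f s'| ≤ (if s' = s then p s' else 0) + p s' * p s := by
      intro s'
      have h3 : |f s'| ≤ (if s' = s then 1 else 0) + p s := by
        refine (abs_sub _ _).trans ?_
        rw [abs_of_nonneg hps]
        split_ifs <;> simp
      have := mul_le_mul_of_nonneg_left h3 (hp.1 s')
      refine this.trans (le_of_eq ?_)
      split_ifs <;> ring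
    refine (Finset.sum_le_sum fun s' _ => this s').trans (le_of_eq ?_)
    rw [Finset.sum_add_distrib, ← Finset.sum_mul, hp.2]
    simp; ring
  have hbadr : ∀ r, (if good r then 0 else a r) * (2 * p s) ≤
      2 * θ ^ (-t) * ((a r * (a r / q) ^ t) * (p s * p s ^ (-t))) := by
    intro r
    have har := ha r
    by_cases h1 : good r
    · simp only [h1, if_true, zero_mul]
      positivity
    · simp only [h1, if_false]
      rcases hps.eq_or_lt with h0 | h0
      · simp [← h0]
      rcases hq0.eq_or_lt with h2 | h2
      · have : a r = 0 := by
          refine le_antisymm ?_ har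
          rw [h2, hq]
          exact Finset.single_le_sum (fun i _ => ha i) (Finset.mem_univ r)
        simp [this]
      have h3 : θ * (q * p s) < a r := not_le.mp (mt (hgood r).2 h1)
      have h4 : 1 ≤ θ ^ (-t) * (a r / q) ^ t * p s ^ (-t) := by
        rw [Real.rpow_neg hθ.le, Real.rpow_neg hps, ← Real.inv_rpow hθ.le, ← Real.inv_rpow hps,
          ← Real.mul_rpow (by positivity) (by positivity),
          ← Real.mul_rpow (by positivity) (by positivity)]
        apply Real.one_le_rpow _ ht
        rw [show θ⁻¹ * (a r / q) * (p s)⁻¹ = a r / (θ * (q * p s)) by field_simp]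
        rw [one_le_div (by positivity)]
        exact h3.le
      calc a r * (2 * p s) = (a r * (2 * p s)) * 1 := by ring
        _ ≤ (a r * (2 * p s)) * (θ ^ (-t) * (a r / q) ^ t * p s ^ (-t)) :=
          mul_le_mul_of_nonneg_left h4 (by positivity)
        _ = _ := by ring
  have hB : ∑ g : R → S, (∏ r, p (g r)) * |∑ r, (if good r then 0 else a r) * f (g r)| ≤
      2 * θ ^ (-t) * ((∑ r, a r * (a r / q) ^ t) * (p s * p s ^ (-t))) := by
    calc _ ≤ ∑ g : R → S, ∑ r, (if good r then 0 else a r) * ((∏ r, p (g r)) * |f (g r)|) := by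
          refine Finset.sum_le_sum fun g _ => ?_
          calc _ ≤ (∏ r, p (g r)) * ∑ r, |(if good r then 0 else a r) * f (g r)| :=
                mul_le_mul_of_nonneg_left (Finset.abs_sum_le_sum_abs _ _) (hw.1 g)
            _ = _ := by
                rw [Finset.mul_sum]
                refine Finset.sum_congr rfl fun r _ => ?_
                rw [abs_mul, abs_of_nonneg (a := if good r then 0 else a r)
                  (by split_ifs; exacts [le_rfl, ha r])]
                ring
      _ = ∑ r, (if good r then 0 else a r) * ∑ s', p s' * |f s'| := by
          rw [Finset.sum_comm]
          refine Finset.sum_congr rfl fun r _ => ?_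
          rw [← Finset.mul_sum, sum_pi_mul_apply (fun _ : R => hp) r (fun s => |f s|)]
      _ ≤ ∑ r, (if good r then 0 else a r) * (2 * p s) := by
          refine Finset.sum_le_sum fun r _ => mul_le_mul_of_nonneg_left habs ?_
          split_ifs
          exacts [le_rfl, ha r]
      _ ≤ _ := by
          refine (Finset.sum_le_sum fun r _ => hbadr r).trans (le_of_eq ?_)
          rw [← Finset.mul_sum, Finset.sum_mul]
  refine le_trans ?_ (add_le_add hA hB)
  rw [← Finset.sum_add_distrib]
  refine Finset.sum_le_sum fun g _ => ?_
  rw [hsplit g, ← mul_add]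
  exact mul_le_mul_of_nonneg_left (abs_add_le _ _) (hw.1 g)

/-- One-shot randomness extraction: some hash of `r` has, jointly with `z`, approximately the
product law with second marginal `p`. -/
lemma exists_hash {Z R S : Type} [Fintype Z] [Fintype R] [Fintype S] {p : S → ℝ} (hp : IsDist p)
    {J : Z → R → ℝ} (hJ : ∀ z r, 0 ≤ J z r) (hJ1 : ∑ z, ∑ r, J z r = 1)
    {t θ : ℝ} (ht : 0 ≤ t) (hθ : 0 < θ) :
    ∃ g : R → S, (∀ r, 0 < p (g r)) ∧
      ∑ z, ∑ s, |∑ r, (if g r = s then J z r else 0) - (∑ r, J z r) * p s| ≤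
        √θ + 2 * θ ^ (-t) * ((∑ z, ∑ r, J z r * (J z r / ∑ r', J z r') ^ t) *
          ∑ s, p s * p s ^ (-t)) := by
  have hw := IsDist.pi (ι := R) (fun _ => hp)
  set L : (R → S) → ℝ := fun g =>
    ∑ z, ∑ s, |∑ r, (if g r = s then J z r else 0) - (∑ r, J z r) * p s| with hL
  set b := √θ + 2 * θ ^ (-t) * ((∑ z, ∑ r, J z r * (J z r / ∑ r', J z r') ^ t) *
          ∑ s, p s * p s ^ (-t)) with hb
  have hmean : ∑ g : R → S, (∏ r, p (g r)) * L g ≤ b := by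
    calc _ = ∑ z, ∑ s, ∑ g : R → S, (∏ r, p (g r)) *
            |∑ r, (if g r = s then J z r else 0) - (∑ r, J z r) * p s| := by
          simp only [hL, Finset.mul_sum]
          rw [Finset.sum_comm]
          refine Finset.sum_congr rfl fun z _ => ?_
          rw [Finset.sum_comm]
      _ ≤ ∑ z, ∑ s, (√θ * ((∑ r, J z r) * p s) +
            2 * θ ^ (-t) * ((∑ r, J z r * (J z r / ∑ r', J z r') ^ t) * (p s * p s ^ (-t)))) :=
          Finset.sum_le_sum fun z _ => Finset.sum_le_sum fun s _ =>
            sum_pi_abs_hash_sub_le hp (hJ z) ht hθ s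
      _ = b := by
          simp only [Finset.sum_add_distrib, ← Finset.mul_sum, hp.2, mul_one, hJ1, hb,
            ← Finset.sum_mul]
  by_contra hcon
  push Not at hcon
  have hpos : 0 < ∑ g : R → S, (∏ r, p (g r)) * (L g - b) := by
    have hex : ∃ g : R → S, 0 < ∏ r, p (g r) := by
      by_contra hne
      push Not at hne
      have : ∑ g : R → S, ∏ r, p (g r) ≤ 0 := Finset.sum_nonpos fun g _ => hne g
      have h2 := hw.2
      simp only at h2
      linarith
    have key : ∀ g : R → S, 0 < ∏ r, p (g r) → b < L g := by
      intro g hg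
      refine hcon g fun r => (hp.1 _).lt_of_ne fun h0 => ?_
      rw [Finset.prod_eq_zero (Finset.mem_univ r) h0.symm] at hg
      exact lt_irrefl _ hg
    refine Finset.sum_pos' (fun g _ => ?_) ?_
    · rcases (hw.1 g).eq_or_lt with h0 | h0
      · simp only at h0
        rw [← h0, zero_mul]
      · exact mul_nonneg h0.le (sub_nonneg.2 (key g h0).le)
    · obtain ⟨g, hg⟩ := hex
      exact ⟨g, Finset.mem_univ g, mul_pos hg (sub_pos.2 (key g hg))⟩
  simp only [mul_sub, Finset.sum_sub_distrib, ← Finset.sum_mul] at hpos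
  have h2 := hw.2
  simp only at h2
  rw [h2] at hpos
  linarith

/-- A single-letter coding scheme: a law of the shared state, an encoder and a decoder. -/
structure TestChannel (X Y B U : Type) [Fintype Y] [Fintype B] [Fintype U] where
  pU : U → ℝ
  pB : U → X → B → ℝ
  pY : U → B → Y → ℝ
  pU_dist : IsDist pU
  pB_dist : ∀ u x, IsDist (pB u x)
  pY_dist : ∀ u b, IsDist (pY u b)

section
variable {W X Y B U : Type} [Fintype W] [Fintype X] [Fintype Y] [Fintype B] [Fintype U]

namespace TestChannel

/-- Joint law of input, output, message and state. -/
def joint (c : TestChannel X Y B U) (πX : X → ℝ) (x : X) (y : Y) (b : B) (u : U) : ℝ :=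
  c.pU u * πX x * c.pB u x b * c.pY u b y

/-- Joint law of input and output. -/
def out (c : TestChannel X Y B U) (πX : X → ℝ) (x : X) (y : Y) : ℝ :=
  ∑ b, ∑ u, c.joint πX x y b u

/-- Power moment of the conditional law of message and state given input and output. -/
def moment (c : TestChannel X Y B U) (πX : X → ℝ) (t : ℝ) : ℝ :=
  ∑ x, ∑ y, ∑ b, ∑ u, c.joint πX x y b u * (c.joint πX x y b u / c.out πX x y) ^ t

/-- Negative power moment of the state law. -/
def stateMoment (c : TestChannel X Y B U) (t : ℝ) : ℝ :=
  ∑ u, c.pU u * c.pU u ^ (-t)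

variable {πX : X → ℝ}

lemma joint_nonneg (c : TestChannel X Y B U) (hX : IsDist πX) (x y b u) :
    0 ≤ c.joint πX x y b u :=
  mul_nonneg (mul_nonneg (mul_nonneg (c.pU_dist.1 u) (hX.1 x)) ((c.pB_dist u x).1 b))
    ((c.pY_dist u b).1 y)

lemma out_nonneg (c : TestChannel X Y B U) (hX : IsDist πX) (x y) : 0 ≤ c.out πX x y :=
  Finset.sum_nonneg fun _ _ => Finset.sum_nonneg fun _ _ => c.joint_nonneg hX _ _ _ _

lemma joint_le_out (c : TestChannel X Y B U) (hX : IsDist πX) (x y b u) :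
    c.joint πX x y b u ≤ c.out πX x y :=
  (Finset.single_le_sum (f := fun u => c.joint πX x y b u)
    (fun _ _ => c.joint_nonneg hX _ _ _ _) (Finset.mem_univ u)).trans
  (Finset.single_le_sum (f := fun b => ∑ u, c.joint πX x y b u)
    (fun _ _ => Finset.sum_nonneg fun _ _ => c.joint_nonneg hX _ _ _ _) (Finset.mem_univ b))

/-- Integrating a function of the state against the joint law. -/
lemma sum_joint_mul (c : TestChannel X Y B U) (hX : IsDist πX) (f : U → ℝ) :
    ∑ x, ∑ y, ∑ b, ∑ u, c.joint πX x y b u * f u = ∑ u, c.pU u * f u := by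
  calc _ = ∑ u, ∑ x, ∑ b, ∑ y, c.joint πX x y b u * f u := by
        rw [Finset.sum_comm (s := (Finset.univ : Finset U))]
        refine Finset.sum_congr rfl fun x _ => ?_
        rw [Finset.sum_comm, Finset.sum_comm (s := (Finset.univ : Finset U))]
        exact Finset.sum_congr rfl fun b _ => Finset.sum_comm
    _ = ∑ u, c.pU u * f u := by
        refine Finset.sum_congr rfl fun u _ => ?_
        have h : ∀ x b y, c.joint πX x y b u * f u =
            c.pU u * f u * πX x * c.pB u x b * c.pY u b y := fun x b y => by
          rw [joint]; ring
        simp only [h, ← Finset.mul_sum, (c.pY_dist _ _).2, (c.pB_dist _ _).2, hX.2, mul_one]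

lemma sum_joint (c : TestChannel X Y B U) (hX : IsDist πX) :
    ∑ x, ∑ y, ∑ b, ∑ u, c.joint πX x y b u = 1 := by
  have := c.sum_joint_mul hX (fun _ => 1)
  simpa [c.pU_dist.2] using this

lemma sum_out (c : TestChannel X Y B U) (hX : IsDist πX) : ∑ x, ∑ y, c.out πX x y = 1 :=
  c.sum_joint hX

lemma out_isDist (c : TestChannel X Y B U) (hX : IsDist πX) :
    IsDist (fun p : X × Y => c.out πX p.1 p.2) :=
  ⟨fun _ => c.out_nonneg hX _ _, by rw [Fintype.sum_prod_type]; exact c.sum_out hX⟩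

end TestChannel

/-- Extraction from a block of letters. -/
lemma exists_block_hash {PW : W → ℝ} (hW : IsDist PW) {πX : X → ℝ} (hX : IsDist πX) {n : ℕ}
    (τ : Fin n → TestChannel X Y B U) {S : Type} [Fintype S] {p : S → ℝ} (hp : IsDist p)
    {t θ : ℝ} (ht : 0 ≤ t) (hθ : 0 < θ) :
    ∃ g : (Fin n → W) → (Fin n → B) → (Fin n → U) → S, (∀ w b u, 0 < p (g w b u)) ∧
      ∑ x : Fin n → X, ∑ y : Fin n → Y, ∑ s, |∑ w : Fin n → W, ∑ b : Fin n → B, ∑ u : Fin n → U,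
        (if g w b u = s then ∏ i, PW (w i) * (τ i).joint πX (x i) (y i) (b i) (u i) else 0) -
          (∏ i, (τ i).out πX (x i) (y i)) * p s| ≤
        √θ + 2 * θ ^ (-t) * ((∏ i, (∑ w, PW w * PW w ^ t) * (τ i).moment πX t) *
          ∑ s, p s * p s ^ (-t)) := by
  set J : (Fin n → X) × (Fin n → Y) → (Fin n → W) × (Fin n → B) × (Fin n → U) → ℝ :=
    fun z r => ∏ i, PW (r.1 i) * (τ i).joint πX (z.1 i) (z.2 i) (r.2.1 i) (r.2.2 i) with hJ
  have hJ0 : ∀ z r, 0 ≤ J z r := fun z r => Finset.prod_nonneg fun i _ =>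
    mul_nonneg (hW.1 _) ((τ i).joint_nonneg hX _ _ _ _)
  have hq : ∀ z, ∑ r, J z r = ∏ i, (τ i).out πX (z.1 i) (z.2 i) := by
    intro z
    have h1 : ∀ i, (τ i).out πX (z.1 i) (z.2 i) =
        ∑ w, ∑ b, ∑ u, PW w * (τ i).joint πX (z.1 i) (z.2 i) b u := by
      intro i
      simp only [← Finset.mul_sum, ← Finset.sum_mul, hW.2, one_mul, TestChannel.out]
    simp only [h1, prod_sum_univ, hJ, Fintype.sum_prod_type]
  have hJ1 : ∑ z, ∑ r, J z r = 1 := by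
    simp only [hq, Fintype.sum_prod_type]
    have := Finset.prod_congr (rfl : (Finset.univ : Finset (Fin n)) = Finset.univ)
      (fun i _ => (τ i).sum_out hX)
    simpa only [prod_sum_univ, Finset.prod_const_one] using this
  have hM : ∑ z, ∑ r, J z r * (J z r / ∑ r', J z r') ^ t =
      ∏ i, (∑ w, PW w * PW w ^ t) * (τ i).moment πX t := by
    have h1 : ∀ i, (∑ w, PW w * PW w ^ t) * (τ i).moment πX t =
        ∑ x, ∑ y, ∑ w, ∑ b, ∑ u, (PW w * (τ i).joint πX x y b u) *
          (PW w * (τ i).joint πX x y b u / (τ i).out πX x y) ^ t := by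
      intro i
      have h2 : ∀ w x y b u, (PW w * (τ i).joint πX x y b u) *
          (PW w * (τ i).joint πX x y b u / (τ i).out πX x y) ^ t =
          (PW w * PW w ^ t) * ((τ i).joint πX x y b u *
            ((τ i).joint πX x y b u / (τ i).out πX x y) ^ t) := by
        intro w x y b u
        rw [mul_div_assoc, Real.mul_rpow (hW.1 w)
          (div_nonneg ((τ i).joint_nonneg hX _ _ _ _) ((τ i).out_nonneg hX _ _))]
        ring
      simp only [h2, ← Finset.mul_sum, ← Finset.sum_mul]
      rfl
    simp only [h1, prod_sum_univ, Fintype.sum_prod_type, hq]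
    refine Finset.sum_congr rfl fun x _ => Finset.sum_congr rfl fun y _ =>
      Finset.sum_congr rfl fun w _ => Finset.sum_congr rfl fun b _ =>
      Finset.sum_congr rfl fun u _ => ?_
    rw [Finset.prod_mul_distrib, Real.finsetProd_rpow _ _ fun i _ =>
      div_nonneg (mul_nonneg (hW.1 _) ((τ i).joint_nonneg hX _ _ _ _)) ((τ i).out_nonneg hX _ _),
      Finset.prod_div_distrib]
  obtain ⟨g, hg, hle⟩ := exists_hash hp hJ0 hJ1 ht hθ
  refine ⟨fun w b u => g (w, b, u), fun w b u => hg _, ?_⟩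
  rw [hM] at hle
  simpa only [hq, Fintype.sum_prod_type] using hle

omit [Fintype X] in
/-- State moment of a block. -/
lemma sum_pi_stateMoment {n : ℕ} (τ : Fin n → TestChannel X Y B U) (t : ℝ) :
    ∑ s : Fin n → U, (∏ i, (τ i).pU (s i)) * (∏ i, (τ i).pU (s i)) ^ (-t) =
      ∏ i, (τ i).stateMoment t := by
  simp only [TestChannel.stateMoment, prod_sum_univ]
  refine Finset.sum_congr rfl fun s _ => ?_
  rw [Finset.prod_mul_distrib, Real.finsetProd_rpow _ _ fun i _ => (τ i).pU_dist.1 _]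

end

lemma sum_fin_append {α : Type} [Fintype α] {N n : ℕ}
    (F : (Fin (N + n) → α) → ℝ) :
    ∑ a, F a = ∑ a : Fin N → α, ∑ a' : Fin n → α, F (Fin.append a a') := by
  rw [← (Fin.appendEquiv N n).sum_comp, Fintype.sum_prod_type]
  rfl

lemma castAdd_lt_natAdd {N n : ℕ} (i : Fin N) (k : Fin n) : Fin.castAdd n i < Fin.natAdd N k := by
  rw [Fin.lt_def, Fin.val_castAdd, Fin.val_natAdd]
  omega

namespace SeqCode
variable {W X Y B : Type} [Fintype W] [Fintype X] [Fintype Y] [Fintype B] {S S' : Type} {N n : ℕ}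

/-- Joint law of the output and of a state computed from the common data, given the input. -/
def joint (C : SeqCode W X Y B N) (PW : W → ℝ) (st : (Fin N → W) → (Fin N → B) → S)
    (x : Fin N → X) (y : Fin N → Y) (s : S) : ℝ :=
  ∑ w, ∑ b, if st w b = s then
    (∏ k, PW (w k)) * (∏ k, C.enc k w x b (b k)) * (∏ k, C.dec k w b y (y k)) else 0

lemma sum_joint [Fintype S] (C : SeqCode W X Y B N) (PW : W → ℝ)
    (st : (Fin N → W) → (Fin N → B) → S) (x : Fin N → X) (y : Fin N → Y) :
    ∑ s, C.joint PW st x y s = C.channel PW x y := by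
  simp only [joint, channel]
  rw [Finset.sum_comm]
  refine Finset.sum_congr rfl fun w _ => ?_
  rw [Finset.sum_comm]
  exact Finset.sum_congr rfl fun b _ => by simp

/-- Extend a code by a block whose letters are coded given the state of the first part. -/
def append (C : SeqCode W X Y B N) (st : (Fin N → W) → (Fin N → B) → S)
    (e : Fin n → S → X → B → ℝ) (d : Fin n → S → B → Y → ℝ)
    (he : ∀ i s x, IsDist (e i s x)) (hd : ∀ i s b, IsDist (d i s b)) :
    SeqCode W X Y B (N + n) where
  enc k w x b := Fin.addCases (motive := fun _ => B → ℝ)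
    (fun k => C.enc k (fun i => w (Fin.castAdd n i)) (fun i => x (Fin.castAdd n i))
      (fun i => b (Fin.castAdd n i)))
    (fun i => e i (st (fun i => w (Fin.castAdd n i)) (fun i => b (Fin.castAdd n i)))
      (x (Fin.natAdd N i))) k
  dec k w b y := Fin.addCases (motive := fun _ => Y → ℝ)
    (fun k => C.dec k (fun i => w (Fin.castAdd n i)) (fun i => b (Fin.castAdd n i))
      (fun i => y (Fin.castAdd n i)))
    (fun i => d i (st (fun i => w (Fin.castAdd n i)) (fun i => b (Fin.castAdd n i)))
      (b (Fin.natAdd N i))) k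
  enc_dist k w x b := by
    induction k using Fin.addCases with
    | left k => simpa using C.enc_dist _ _ _ _
    | right k => simpa using he _ _ _
  dec_dist k w b y := by
    induction k using Fin.addCases with
    | left k => simpa using C.dec_dist _ _ _ _
    | right k => simpa using hd _ _ _
  enc_causal k w w' x x' b b' hw hx hb := by
    induction k using Fin.addCases with
    | left k =>
      simp only [Fin.addCases_left]
      exact C.enc_causal _ _ _ _ _ _ _ (fun i hi => hw _ hi)
        (fun i hi => hx _ hi) (fun i hi => hb _ hi)
    | right k =>
      simp only [Fin.addCases_right]
      have h1 : (fun i => w (Fin.castAdd n i)) = fun i => w' (Fin.castAdd n i) :=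
        funext fun i => hw _ (castAdd_lt_natAdd i k).le
      have h2 : (fun i => b (Fin.castAdd n i)) = fun i => b' (Fin.castAdd n i) :=
        funext fun i => hb _ (castAdd_lt_natAdd i k)
      rw [h1, h2, hx _ le_rfl]
  dec_causal k w w' b b' y y' hw hb hy := by
    induction k using Fin.addCases with
    | left k =>
      simp only [Fin.addCases_left]
      exact C.dec_causal _ _ _ _ _ _ _ (fun i hi => hw _ hi)
        (fun i hi => hb _ hi) (fun i hi => hy _ hi)
    | right k =>
      simp only [Fin.addCases_right]
      have h1 : (fun i => w (Fin.castAdd n i)) = fun i => w' (Fin.castAdd n i) :=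
        funext fun i => hw _ (castAdd_lt_natAdd i k).le
      have h2 : (fun i => b (Fin.castAdd n i)) = fun i => b' (Fin.castAdd n i) :=
        funext fun i => hb _ (castAdd_lt_natAdd i k).le
      rw [h1, h2, hb _ le_rfl]

lemma joint_append [Fintype S] (C : SeqCode W X Y B N) (PW : W → ℝ)
    (st : (Fin N → W) → (Fin N → B) → S)
    (e : Fin n → S → X → B → ℝ) (d : Fin n → S → B → Y → ℝ)
    (he : ∀ i s x, IsDist (e i s x)) (hd : ∀ i s b, IsDist (d i s b))
    (g : (Fin n → W) → (Fin n → B) → S → S') (x : Fin N → X) (x' : Fin n → X)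
    (y : Fin N → Y) (y' : Fin n → Y) (s' : S') :
    (C.append st e d he hd).joint PW
      (fun w b => g (fun i => w (Fin.natAdd N i)) (fun i => b (Fin.natAdd N i))
        (st (fun i => w (Fin.castAdd n i)) (fun i => b (Fin.castAdd n i))))
      (Fin.append x x') (Fin.append y y') s' =
    ∑ s, C.joint PW st x y s * ∑ w' : Fin n → W, ∑ b' : Fin n → B,
      if g w' b' s = s' then
        (∏ i, PW (w' i)) * (∏ i, e i s (x' i) (b' i)) * (∏ i, d i s (b' i) (y' i)) else 0 := by
  have h1 : ∀ s, C.joint PW st x y s * (∑ w' : Fin n → W, ∑ b' : Fin n → B,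
      if g w' b' s = s' then
        (∏ i, PW (w' i)) * (∏ i, e i s (x' i) (b' i)) * (∏ i, d i s (b' i) (y' i)) else 0) =
      ∑ w, ∑ w' : Fin n → W, ∑ b, ∑ b' : Fin n → B, if st w b = s then (if g w' b' s = s' then
        ((∏ k, PW (w k)) * (∏ k, C.enc k w x b (b k)) * (∏ k, C.dec k w b y (y k))) *
        ((∏ i, PW (w' i)) * (∏ i, e i s (x' i) (b' i)) * (∏ i, d i s (b' i) (y' i))) else 0)
        else 0 := by
    intro s
    rw [joint, Finset.sum_mul_sum]
    refine Finset.sum_congr rfl fun w _ => Finset.sum_congr rfl fun w' _ => ?_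
    rw [Finset.sum_mul_sum]
    refine Finset.sum_congr rfl fun b _ => Finset.sum_congr rfl fun b' _ => ?_
    split_ifs <;> simp
  simp only [h1]
  rw [Finset.sum_comm (s := (Finset.univ : Finset S)), joint, sum_fin_append]
  refine Finset.sum_congr rfl fun w _ => ?_
  rw [Finset.sum_comm (s := (Finset.univ : Finset S))]
  refine Finset.sum_congr rfl fun w' _ => ?_
  rw [Finset.sum_comm (s := (Finset.univ : Finset S)), sum_fin_append]
  refine Finset.sum_congr rfl fun b _ => ?_
  rw [Finset.sum_comm (s := (Finset.univ : Finset S))]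
  refine Finset.sum_congr rfl fun b' _ => ?_
  rw [Finset.sum_ite_eq]
  simp only [Finset.mem_univ, if_true, append, Fin.prod_univ_add, Fin.append_left,
    Fin.append_right, Fin.addCases_left, Fin.addCases_right]
  split_ifs
  · ring
  · rfl

end SeqCode

section
variable {W X Y B U S S' : Type} [Fintype W] [Fintype X] [Fintype Y] [Fintype B] [Fintype U]
  {N n : ℕ}

/-- Law of a block of inputs and outputs and of the hash, given the state sequence. -/
def blockKernel (PW : W → ℝ) (πX : X → ℝ) (τ : Fin n → TestChannel X Y B U)
    (g : (Fin n → W) → (Fin n → B) → (Fin n → U) → S) (u : Fin n → U)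
    (x : Fin n → X) (y : Fin n → Y) (s : S) : ℝ :=
  ∑ w : Fin n → W, ∑ b : Fin n → B, if g w b u = s then
    ∏ i, πX (x i) * (PW (w i) * (τ i).pB (u i) (x i) (b i) * (τ i).pY (u i) (b i) (y i)) else 0

variable {PW : W → ℝ} {πX : X → ℝ}

lemma blockKernel_nonneg (hW : IsDist PW) (hX : IsDist πX) (τ : Fin n → TestChannel X Y B U)
    (g : (Fin n → W) → (Fin n → B) → (Fin n → U) → S) (u : Fin n → U)
    (x : Fin n → X) (y : Fin n → Y) (s : S) : 0 ≤ blockKernel PW πX τ g u x y s :=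
  Finset.sum_nonneg fun w _ => Finset.sum_nonneg fun b _ => by
    split_ifs
    · exact Finset.prod_nonneg fun i _ => mul_nonneg (hX.1 _) (mul_nonneg (mul_nonneg (hW.1 _)
        (((τ i).pB_dist _ _).1 _)) (((τ i).pY_dist _ _).1 _))
    · exact le_rfl

lemma sum_blockKernel [Fintype S] (hW : IsDist PW) (hX : IsDist πX)
    (τ : Fin n → TestChannel X Y B U)
    (g : (Fin n → W) → (Fin n → B) → (Fin n → U) → S) (u : Fin n → U) :
    ∑ x, ∑ y, ∑ s, blockKernel PW πX τ g u x y s = 1 := by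
  have h1 : ∀ x y, ∑ s, blockKernel PW πX τ g u x y s = ∑ w : Fin n → W, ∑ b : Fin n → B,
      ∏ i, πX (x i) * (PW (w i) * (τ i).pB (u i) (x i) (b i) * (τ i).pY (u i) (b i) (y i)) := by
    intro x y
    simp only [blockKernel]
    rw [Finset.sum_comm]
    refine Finset.sum_congr rfl fun w _ => ?_
    rw [Finset.sum_comm]
    exact Finset.sum_congr rfl fun b _ => by simp
  have h2 : ∀ i, ∑ x, ∑ y, ∑ w, ∑ b,
      πX x * (PW w * (τ i).pB (u i) x b * (τ i).pY (u i) b y) = 1 := by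
    intro i
    calc _ = ∑ x, ∑ w, ∑ b, ∑ y,
          πX x * (PW w * (τ i).pB (u i) x b * (τ i).pY (u i) b y) := by
          refine Finset.sum_congr rfl fun x _ => ?_
          rw [Finset.sum_comm]
          exact Finset.sum_congr rfl fun w _ => Finset.sum_comm
      _ = 1 := by
          simp only [← Finset.mul_sum, ((τ i).pY_dist _ _).2, ((τ i).pB_dist _ _).2, hX.2, hW.2,
            mul_one]
  have h3 : ∏ i : Fin n, ∑ x, ∑ y, ∑ w, ∑ b,
      πX x * (PW w * (τ i).pB (u i) x b * (τ i).pY (u i) b y) = 1 :=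
    Finset.prod_eq_one fun i _ => h2 i
  simp only [prod_sum_univ] at h3
  simp only [h1, h3]

omit [Fintype X] in
lemma sum_pU_mul_blockKernel (τ : Fin n → TestChannel X Y B U)
    (g : (Fin n → W) → (Fin n → B) → (Fin n → U) → S)
    (x : Fin n → X) (y : Fin n → Y) (s : S) :
    ∑ u : Fin n → U, (∏ i, (τ i).pU (u i)) * blockKernel PW πX τ g u x y s =
      ∑ w : Fin n → W, ∑ b : Fin n → B, ∑ u : Fin n → U, if g w b u = s then
        ∏ i, PW (w i) * (τ i).joint πX (x i) (y i) (b i) (u i) else 0 := by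
  simp only [blockKernel, Finset.mul_sum]
  rw [Finset.sum_comm]
  refine Finset.sum_congr rfl fun w _ => ?_
  rw [Finset.sum_comm]
  refine Finset.sum_congr rfl fun b _ => Finset.sum_congr rfl fun u _ => ?_
  split_ifs
  · rw [← Finset.prod_mul_distrib]
    refine Finset.prod_congr rfl fun i _ => ?_
    rw [TestChannel.joint]
    ring
  · rw [mul_zero]

namespace SeqCode

/-- The code `C` with state map `st` nearly achieves the product law `τ × p` of inputs, outputs
and state. -/
structure IsApprox [Fintype S] (C : SeqCode W X Y B N) (PW : W → ℝ) (πX : X → ℝ)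
    (st : (Fin N → W) → (Fin N → B) → S) (τ : Fin N → TestChannel X Y B U) (p : S → ℝ)
    (η : ℝ) : Prop where
  dist_le : ∑ x, ∑ y, ∑ s, |(∏ i, πX (x i)) * C.joint PW st x y s -
    (∏ i, (τ i).out πX (x i) (y i)) * p s| ≤ η
  supp : ∀ x y s, (∏ i, (τ i).out πX (x i) (y i)) * p s = 0 →
    (∏ i, πX (x i)) * C.joint PW st x y s = 0

/-- The empty code with a deterministic state. -/
lemma exists_isApprox_zero [Fintype S] (PW : W → ℝ) (πX : X → ℝ) (s₀ : S)
    (τ : Fin 0 → TestChannel X Y B U) {p : S → ℝ} (hp : ∀ s, p s = if s₀ = s then 1 else 0) :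
    ∃ (C : SeqCode W X Y B 0) (st : (Fin 0 → W) → (Fin 0 → B) → S),
      C.IsApprox PW πX st τ p 0 := by
  refine ⟨⟨fun k => k.elim0, fun k => k.elim0, fun k => k.elim0, fun k => k.elim0,
    fun k => k.elim0, fun k => k.elim0⟩, fun _ _ => s₀, ?_, ?_⟩
  · simp [joint, hp]
  · intro x y s
    simp [joint, hp]

/-- Append a block to a code whose state drives the block, and hash the data of the block into
the new state. -/
lemma IsApprox.exists_append [Fintype S] (hW : IsDist PW) (hX : IsDist πX)
    {C : SeqCode W X Y B N} {τ : Fin N → TestChannel X Y B U} {τ' : Fin n → TestChannel X Y B U}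
    {st : (Fin N → W) → (Fin N → B) → (Fin n → U)} {η : ℝ}
    (hC : C.IsApprox PW πX st τ (fun u => ∏ i, (τ' i).pU (u i)) η) {p : S → ℝ} (hp : IsDist p)
    {t θ : ℝ} (ht : 0 ≤ t) (hθ : 0 < θ) :
    ∃ (C' : SeqCode W X Y B (N + n)) (st' : (Fin (N + n) → W) → (Fin (N + n) → B) → S),
      C'.IsApprox PW πX st' (Fin.append τ τ') p (η + (√θ + 2 * θ ^ (-t) *
        ((∏ i, (∑ w, PW w * PW w ^ t) * (τ' i).moment πX t) * ∑ s, p s * p s ^ (-t)))) := by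
  obtain ⟨g, hg, hle⟩ := exists_block_hash hW hX τ' hp ht hθ
  have he : ∀ (i : Fin n) (s : Fin n → U) (x : X), IsDist ((τ' i).pB (s i) x) :=
    fun i s x => (τ' i).pB_dist _ _
  have hd : ∀ (i : Fin n) (s : Fin n → U) (b : B), IsDist ((τ' i).pY (s i) b) :=
    fun i s x => (τ' i).pY_dist _ _
  have hjoint : ∀ (x : Fin N → X) (x' : Fin n → X) (y : Fin N → Y) (y' : Fin n → Y) (s' : S),
      (∏ i, πX (Fin.append x x' i)) *
      (C.append st (fun i s x => (τ' i).pB (s i) x) (fun i s b => (τ' i).pY (s i) b) he hd).joint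
        PW (fun w b => g (fun i => w (Fin.natAdd N i)) (fun i => b (Fin.natAdd N i))
        (st (fun i => w (Fin.castAdd n i)) (fun i => b (Fin.castAdd n i))))
        (Fin.append x x') (Fin.append y y') s' =
      ∑ u, ((∏ i, πX (x i)) * C.joint PW st x y u) * blockKernel PW πX τ' g u x' y' s' := by
    intro x x' y y' s'
    rw [joint_append, Finset.mul_sum, Fin.prod_univ_add]
    refine Finset.sum_congr rfl fun u _ => ?_
    simp only [Fin.append_left, Fin.append_right]
    rw [mul_mul_mul_comm]
    congr 1
    rw [blockKernel, Finset.mul_sum]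
    refine Finset.sum_congr rfl fun w _ => ?_
    rw [Finset.mul_sum]
    refine Finset.sum_congr rfl fun b _ => ?_
    split_ifs
    · simp only [Finset.prod_mul_distrib]
    · rw [mul_zero]
  refine ⟨C.append st (fun i s x => (τ' i).pB (s i) x) (fun i s b => (τ' i).pY (s i) b) he hd,
    fun w b => g (fun i => w (Fin.natAdd N i)) (fun i => b (Fin.natAdd N i))
      (st (fun i => w (Fin.castAdd n i)) (fun i => b (Fin.castAdd n i))), ⟨?_, ?_⟩⟩
  rotate_left
  · intro x y s' h0
    obtain ⟨⟨x, x'⟩, rfl⟩ := (Fin.appendEquiv N n).surjective x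
    obtain ⟨⟨y, y'⟩, rfl⟩ := (Fin.appendEquiv N n).surjective y
    refine (hjoint x x' y y' s').trans ?_
    refine Finset.sum_eq_zero fun u _ => ?_
    by_contra hne
    have hA := left_ne_zero_of_mul hne
    have hk := right_ne_zero_of_mul hne
    have hQ := mt (hC.supp x y u) hA
    have hQ1 := left_ne_zero_of_mul hQ
    have hQ2 := right_ne_zero_of_mul hQ
    rcases mul_eq_zero.1 h0 with h0 | h0
    · simp only [Fin.appendEquiv, Equiv.coe_fn_mk, Fin.prod_univ_add, Fin.append_left,
        Fin.append_right] at h0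
      rcases mul_eq_zero.1 h0 with h0 | h0
      · exact hQ1 h0
      · obtain ⟨i, -, hi⟩ := Finset.prod_eq_zero_iff.1 h0
        refine hk (Finset.sum_eq_zero fun w _ => Finset.sum_eq_zero fun b _ => ?_)
        split_ifs
        · refine Finset.prod_eq_zero (Finset.mem_univ i) ?_
          have h1 : (τ' i).joint πX (x' i) (y' i) (b i) (u i) = 0 :=
            le_antisymm (hi ▸ (τ' i).joint_le_out hX _ _ _ _) ((τ' i).joint_nonneg hX _ _ _ _)
          have h2 := Finset.prod_ne_zero_iff.1 hQ2 i (Finset.mem_univ i)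
          rw [TestChannel.joint] at h1
          have h3 : (τ' i).pU (u i) * (πX (x' i) *
            (PW (w i) * (τ' i).pB (u i) (x' i) (b i) * (τ' i).pY (u i) (b i) (y' i))) = 0 := by
            rw [show (τ' i).pU (u i) * (πX (x' i) *
              (PW (w i) * (τ' i).pB (u i) (x' i) (b i) * (τ' i).pY (u i) (b i) (y' i))) =
              PW (w i) * ((τ' i).pU (u i) * πX (x' i) * (τ' i).pB (u i) (x' i) (b i) *
                (τ' i).pY (u i) (b i) (y' i)) by ring, h1, mul_zero]
          exact (mul_eq_zero.1 h3).resolve_left h2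
        · rfl
    · refine hk (Finset.sum_eq_zero fun w _ => Finset.sum_eq_zero fun b _ => ?_)
      rw [if_neg]
      rintro rfl
      exact (hg w b u).ne' h0
  · set Q : (Fin N → X) → (Fin N → Y) → ℝ := fun x y => ∏ i, (τ i).out πX (x i) (y i) with hQ
    set A : (Fin N → X) → (Fin N → Y) → (Fin n → U) → ℝ :=
      fun x y u => (∏ i, πX (x i)) * C.joint PW st x y u with hA
    set pu : (Fin n → U) → ℝ := fun u => ∏ i, (τ' i).pU (u i) with hpu
    set q : (Fin n → X) → (Fin n → Y) → ℝ := fun x y => ∏ i, (τ' i).out πX (x i) (y i) with hq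
    set k := blockKernel PW πX τ' g with hk
    have hQ0 : ∀ x y, 0 ≤ Q x y := fun x y => Finset.prod_nonneg fun i _ => (τ i).out_nonneg hX _ _
    have hQ1 : ∑ x, ∑ y, Q x y = 1 := by
      have := Finset.prod_congr (rfl : (Finset.univ : Finset (Fin N)) = Finset.univ)
        (fun i _ => (τ i).sum_out hX)
      simpa only [prod_sum_univ, Finset.prod_const_one] using this
    have hk0 : ∀ u x y s, 0 ≤ k u x y s := blockKernel_nonneg hW hX τ' g
    have hk1 : ∀ u, ∑ x, ∑ y, ∑ s, k u x y s = 1 := sum_blockKernel hW hX τ' g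
    simp only [← sum_pU_mul_blockKernel] at hle
    have hpt : ∀ x x' y y' s', |∑ u, A x y u * k u x' y' s' - Q x y * q x' y' * p s'| ≤
        ∑ u, |A x y u - Q x y * pu u| * k u x' y' s' +
          Q x y * |∑ u, pu u * k u x' y' s' - q x' y' * p s'| := by
      intro x x' y y' s'
      have h1 : ∑ u, A x y u * k u x' y' s' - Q x y * q x' y' * p s' =
          ∑ u, (A x y u - Q x y * pu u) * k u x' y' s' +
          Q x y * (∑ u, pu u * k u x' y' s' - q x' y' * p s') := by
        simp only [sub_mul, Finset.sum_sub_distrib, mul_sub, Finset.mul_sum, mul_assoc]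
        ring
      rw [h1]
      refine (abs_add_le _ _).trans (add_le_add ?_ ?_)
      · refine (Finset.abs_sum_le_sum_abs _ _).trans (Finset.sum_le_sum fun u _ => ?_)
        rw [abs_mul, abs_of_nonneg (hk0 _ _ _ _)]
      · rw [abs_mul, abs_of_nonneg (hQ0 _ _)]
    calc _ = ∑ x, ∑ x', ∑ y, ∑ y', ∑ s',
          |∑ u, A x y u * k u x' y' s' - Q x y * q x' y' * p s'| := by
          simp only [sum_fin_append]
          refine Finset.sum_congr rfl fun x _ => Finset.sum_congr rfl fun x' _ =>
            Finset.sum_congr rfl fun y _ => Finset.sum_congr rfl fun y' _ =>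
            Finset.sum_congr rfl fun s' _ => ?_
          rw [hjoint]
          simp only [Fin.prod_univ_add, Fin.append_left, Fin.append_right, hQ, hA, hq, hk]
      _ ≤ ∑ x, ∑ x', ∑ y, ∑ y', ∑ s', (∑ u, |A x y u - Q x y * pu u| * k u x' y' s' +
          Q x y * |∑ u, pu u * k u x' y' s' - q x' y' * p s'|) := by
          gcongr
          apply hpt
      _ = ∑ x, ∑ y, ∑ u, |A x y u - Q x y * pu u| * (∑ x', ∑ y', ∑ s', k u x' y' s') +
          (∑ x, ∑ y, Q x y) * ∑ x', ∑ y', ∑ s', |∑ u, pu u * k u x' y' s' - q x' y' * p s'| := by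
          simp only [Finset.sum_add_distrib]
          congr 1
          · refine Finset.sum_congr rfl fun x _ => ?_
            rw [Finset.sum_comm]
            refine Finset.sum_congr rfl fun y _ => ?_
            simp only [Finset.mul_sum]
            rw [Finset.sum_comm (s := (Finset.univ : Finset (Fin n → U)))]
            refine Finset.sum_congr rfl fun x' _ => ?_
            rw [Finset.sum_comm (s := (Finset.univ : Finset (Fin n → U)))]
            refine Finset.sum_congr rfl fun y' _ => ?_
            rw [Finset.sum_comm]
          · rw [Finset.sum_mul]
            refine Finset.sum_congr rfl fun x _ => ?_
            rw [Finset.sum_comm, Finset.sum_mul]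
            refine Finset.sum_congr rfl fun y _ => ?_
            simp only [Finset.mul_sum]
      _ ≤ _ := by
          simp only [hk1, mul_one, hQ1, one_mul]
          exact add_le_add hC.dist_le hle

end SeqCode
end

lemma mul_log_le_mul_log_add {r s M : ℝ} (hr : 0 ≤ r) (hs : 0 ≤ s) (hM : 1 ≤ M) (hrM : r ≤ M) :
    r * Real.log r ≤ s * Real.log s + |r - s| * (1 + Real.log M) + 1 := by
  have hlM : 0 ≤ Real.log M := Real.log_nonneg hM
  rcases hr.eq_or_lt with rfl | hr
  · have h2 : -1 ≤ s * Real.log s := by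
      rcases hs.eq_or_lt with rfl | hs
      · simp
      · have := mul_le_mul_of_nonneg_left (Real.one_sub_inv_le_log_of_pos hs) hs.le
        rw [mul_sub, mul_inv_cancel₀ hs.ne'] at this
        linarith
    have := mul_nonneg (abs_nonneg (0 - s)) (by linarith : 0 ≤ 1 + Real.log M)
    simp only [zero_mul]
    linarith
  have hrl : Real.log r ≤ Real.log M := Real.log_le_log hr hrM
  rcases hs.eq_or_lt with rfl | hs
  · have := mul_le_mul_of_nonneg_left hrl hr.le
    rw [sub_zero, abs_of_pos hr]
    linarith
  have hls : s - r ≤ s * (Real.log s - Real.log r) := by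
    have := mul_le_mul_of_nonneg_left (Real.one_sub_inv_le_log_of_pos (div_pos hs hr)) hs.le
    rw [Real.log_div hs.ne' hr.ne', inv_div, mul_sub, mul_div_cancel₀ _ hs.ne'] at this
    linarith
  rcases le_total s r with h | h
  · have := mul_le_mul_of_nonneg_left hrl (sub_nonneg.2 h)
    rw [abs_of_nonneg (sub_nonneg.2 h)]
    nlinarith
  · have h3 := mul_nonneg (abs_nonneg (r - s)) (by linarith : 0 ≤ 1 + Real.log M)
    rcases le_total 1 s with h1 | h1
    · have h4 := mul_le_mul_of_nonneg_left (Real.log_le_log hr h) hr.le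
      have h5 := mul_le_mul_of_nonneg_right h (Real.log_nonneg h1)
      linarith
    · have h4 := mul_nonpos_of_nonneg_of_nonpos hr.le (Real.log_nonpos hr.le (h.trans h1))
      have := mul_le_mul_of_nonneg_left (Real.one_sub_inv_le_log_of_pos hs) hs.le
      rw [mul_sub, mul_inv_cancel₀ hs.ne'] at this
      linarith

lemma mul_log_div_le {p q r M : ℝ} (hp : 0 ≤ p) (hq : 0 ≤ q) (hr : 0 < r) (hM : 1 ≤ M)
    (hpM : p ≤ M * r) :
    p * Real.log (p / r) ≤ q * Real.log (q / r) + |p - q| * (1 + Real.log M) + r := by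
  have h := mul_le_mul_of_nonneg_left (mul_log_le_mul_log_add (div_nonneg hp hr.le)
    (div_nonneg hq hr.le) hM ((div_le_iff₀ hr).2 hpM)) hr.le
  rw [← sub_div, abs_div, abs_of_pos hr] at h
  have e1 : ∀ a b : ℝ, r * (a / r * b) = a * b := fun a b => by field_simp
  rw [mul_add, mul_add, e1, e1, e1, mul_one] at h
  exact h

/-- Divergence is controlled by the divergence of a nearby law. -/
lemma KL_le_of_sum_abs_sub_le {α : Type} [Fintype α] {P Q R : α → ℝ} (hP : ∀ a, 0 ≤ P a)
    (hQ : IsDist Q) (hR : IsDist R) (hPR : ∀ a, R a = 0 → P a = 0) (hQR : ∀ a, R a = 0 → Q a = 0)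
    {M η : ℝ} (hM : 1 ≤ M) (hPM : ∀ a, P a ≤ M * R a) (hη : ∑ a, |P a - Q a| ≤ η) :
    KL P R ≤ ENNReal.ofReal
      (∑ a, Q a * Real.log (Q a / R a) + (1 + Real.log M) * η + 1) := by
  have hlM : 0 ≤ Real.log M := Real.log_nonneg hM
  rw [KL, if_pos hPR]
  apply ENNReal.ofReal_le_ofReal
  calc _ ≤ ∑ a, (Q a * Real.log (Q a / R a) + |P a - Q a| * (1 + Real.log M) + R a) := by
        refine Finset.sum_le_sum fun a _ => ?_
        rcases (hR.1 a).eq_or_lt with h | h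
        · simp [hPR a h.symm, hQR a h.symm, ← h]
        · exact mul_log_div_le (hP a) (hQ.1 a) h hM (hPM a)
    _ = ∑ a, Q a * Real.log (Q a / R a) + (1 + Real.log M) * ∑ a, |P a - Q a| + 1 := by
        rw [Finset.sum_add_distrib, Finset.sum_add_distrib, hR.2, ← Finset.sum_mul, mul_comm
          (∑ a, |P a - Q a|)]
    _ ≤ _ := by gcongr

/-- Divergence of product laws is additive. -/
lemma sum_prod_mul_log_div {α : Type} [Fintype α] {N : ℕ} {q : Fin N → α → ℝ} {r : α → ℝ}
    (hq : ∀ i, IsDist (q i)) (hqr : ∀ i a, r a = 0 → q i a = 0) :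
    ∑ a : Fin N → α, (∏ i, q i (a i)) * Real.log ((∏ i, q i (a i)) / ∏ i, r (a i)) =
      ∑ i, ∑ a, q i a * Real.log (q i a / r a) := by
  calc _ = ∑ a : Fin N → α, ∑ j, (∏ i, q i (a i)) * Real.log (q j (a j) / r (a j)) := by
        refine Finset.sum_congr rfl fun a _ => ?_
        rw [← Finset.mul_sum]
        by_cases h : ∏ i, q i (a i) = 0
        · rw [h, zero_mul, zero_mul]
        · rw [← Finset.prod_div_distrib, Real.log_prod]
          intro i _
          have hi := Finset.prod_ne_zero_iff.1 h i (Finset.mem_univ i)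
          exact div_ne_zero hi (mt (hqr i _) hi)
    _ = _ := by
        rw [Finset.sum_comm]
        exact Finset.sum_congr rfl fun j _ =>
          sum_pi_mul_apply hq j (fun a => Real.log (q j a / r a))

section
variable {W X Y B U S : Type} [Fintype W] [Fintype X] [Fintype Y] [Fintype B] [Fintype U]
  [Fintype S] {N : ℕ}

/-- Divergence of the output law of a test channel from a target law. -/
def TestChannel.div (c : TestChannel X Y B U) (πX : X → ℝ) (π : X × Y → ℝ) : ℝ :=
  ∑ a : X × Y, c.out πX a.1 a.2 * Real.log (c.out πX a.1 a.2 / π a)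

lemma SeqCode.channel_nonneg (C : SeqCode W X Y B N) {PW : W → ℝ} (hW : IsDist PW) (x y) :
    0 ≤ C.channel PW x y :=
  Finset.sum_nonneg fun _ _ => Finset.sum_nonneg fun _ _ => mul_nonneg (mul_nonneg
    (Finset.prod_nonneg fun _ _ => hW.1 _) (Finset.prod_nonneg fun _ _ => (C.enc_dist _ _ _ _).1 _))
    (Finset.prod_nonneg fun _ _ => (C.dec_dist _ _ _ _).1 _)

lemma exists_pos_le_of_ne_zero {α : Type} [Fintype α] {p : α → ℝ} (hp : IsDist p) :
    ∃ δ : ℝ, 0 < δ ∧ δ ≤ 1 ∧ ∀ a, p a ≠ 0 → δ ≤ p a := by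
  have : ∀ s : Finset α, ∃ δ : ℝ, 0 < δ ∧ δ ≤ 1 ∧ ∀ a ∈ s, p a ≠ 0 → δ ≤ p a := by
    intro s
    induction s using Finset.induction_on with
    | empty => exact ⟨1, one_pos, le_rfl, by simp⟩
    | insert a s _ ih =>
      obtain ⟨δ, h0, h1, h⟩ := ih
      by_cases ha : p a = 0
      · refine ⟨δ, h0, h1, fun b hb hb0 => ?_⟩
        rcases Finset.mem_insert.1 hb with rfl | hb
        · exact absurd ha hb0
        · exact h b hb hb0
      · refine ⟨min δ (p a), lt_min h0 (lt_of_le_of_ne (hp.1 a) (Ne.symm ha)),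
          (min_le_left _ _).trans h1, fun b hb hb0 => ?_⟩
        rcases Finset.mem_insert.1 hb with rfl | hb
        · exact min_le_right _ _
        · exact (min_le_left _ _).trans (h b hb hb0)
  obtain ⟨δ, h0, h1, h⟩ := this Finset.univ
  exact ⟨δ, h0, h1, fun a => h a (Finset.mem_univ a)⟩

/-- Divergence achieved by an approximate code. -/
lemma SeqCode.IsApprox.KL_le {PW : W → ℝ} (hW : IsDist PW) {π : X × Y → ℝ} (hπ : IsDist π)
    {πX : X → ℝ} (hX : IsDist πX) {δ : ℝ} (hδ : 0 < δ) (hδ1 : δ ≤ 1)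
    (hδπ : ∀ a, π a ≠ 0 → δ ≤ π a) {C : SeqCode W X Y B N}
    {st : (Fin N → W) → (Fin N → B) → S} {τ : Fin N → TestChannel X Y B U} {p : S → ℝ}
    (hp : IsDist p) {η : ℝ} (h : C.IsApprox PW πX st τ p η) (hη : η ≤ 1)
    (hτ : ∀ i a, π a = 0 → (τ i).out πX a.1 a.2 = 0) :
    KL (fun p : (Fin N → X) × (Fin N → Y) => (∏ i, πX (p.1 i)) * C.channel PW p.1 p.2)
        (fun p : (Fin N → X) × (Fin N → Y) => ∏ i, π (p.1 i, p.2 i)) ≤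
      ENNReal.ofReal (∑ i, (τ i).div πX π +
        (1 + (Real.log 2 + N * -Real.log δ)) * η + 1) := by
  set e : (Fin N → X × Y) ≃ (Fin N → X) × (Fin N → Y) := Equiv.arrowProdEquivProdArrow _ _ _
  have hQ : IsDist (fun a : (Fin N → X) × (Fin N → Y) => ∏ i, (τ i).out πX (a.1 i) (a.2 i)) := by
    have := IsDist.pi fun i => (τ i).out_isDist hX
    refine ⟨fun a => Finset.prod_nonneg fun i _ => (τ i).out_nonneg hX _ _, ?_⟩
    rw [← e.sum_comp]
    exact this.2
  have hR : IsDist (fun a : (Fin N → X) × (Fin N → Y) => ∏ i, π (a.1 i, a.2 i)) := by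
    have := IsDist.pi fun _ : Fin N => hπ
    refine ⟨fun a => Finset.prod_nonneg fun i _ => hπ.1 _, ?_⟩
    rw [← e.sum_comp]
    exact this.2
  have hP : ∀ x y, 0 ≤ (∏ i, πX (x i)) * C.channel PW x y := fun x y =>
    mul_nonneg (Finset.prod_nonneg fun i _ => hX.1 _) (C.channel_nonneg hW _ _)
  have hQR : ∀ a : (Fin N → X) × (Fin N → Y), ∏ i, π (a.1 i, a.2 i) = 0 →
      ∏ i, (τ i).out πX (a.1 i) (a.2 i) = 0 := by
    intro a ha
    obtain ⟨i, hi, h0⟩ := Finset.prod_eq_zero_iff.1 ha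
    exact Finset.prod_eq_zero hi (hτ i _ h0)
  have hPR : ∀ a : (Fin N → X) × (Fin N → Y), ∏ i, π (a.1 i, a.2 i) = 0 →
      (∏ i, πX (a.1 i)) * C.channel PW a.1 a.2 = 0 := by
    intro a ha
    rw [← C.sum_joint PW st, Finset.mul_sum]
    exact Finset.sum_eq_zero fun s _ => h.supp _ _ _ (by rw [hQR a ha, zero_mul])
  have hη' : ∑ a : (Fin N → X) × (Fin N → Y), |(∏ i, πX (a.1 i)) * C.channel PW a.1 a.2 -
      ∏ i, (τ i).out πX (a.1 i) (a.2 i)| ≤ η := by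
    refine le_trans ?_ h.dist_le
    rw [Fintype.sum_prod_type]
    refine Finset.sum_le_sum fun x _ => Finset.sum_le_sum fun y _ => ?_
    rw [← C.sum_joint PW st]
    calc _ = |∑ s, ((∏ i, πX (x i)) * C.joint PW st x y s -
          (∏ i, (τ i).out πX (x i) (y i)) * p s)| := by
          rw [Finset.sum_sub_distrib, ← Finset.mul_sum, ← Finset.mul_sum, hp.2, mul_one]
      _ ≤ _ := Finset.abs_sum_le_sum_abs _ _
  have hPM : ∀ a : (Fin N → X) × (Fin N → Y), (∏ i, πX (a.1 i)) * C.channel PW a.1 a.2 ≤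
      2 * (δ ^ N)⁻¹ * ∏ i, π (a.1 i, a.2 i) := by
    intro a
    by_cases h0 : ∏ i, π (a.1 i, a.2 i) = 0
    · rw [hPR a h0, h0, mul_zero]
    · have h1 : δ ^ N ≤ ∏ i, π (a.1 i, a.2 i) := by
        calc δ ^ N = ∏ _i : Fin N, δ := by simp
          _ ≤ _ := Finset.prod_le_prod (fun _ _ => hδ.le) fun i hi =>
            hδπ _ (Finset.prod_ne_zero_iff.1 h0 i hi)
      have h2 := (Finset.single_le_sum (fun a _ => abs_nonneg ((∏ i, πX (a.1 i)) *
        C.channel PW a.1 a.2 - ∏ i, (τ i).out πX (a.1 i) (a.2 i))) (Finset.mem_univ a)).trans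
        (hη'.trans hη)
      have h3 := hQ.le_one a
      have h4 := le_abs_self ((∏ i, πX (a.1 i)) *
        C.channel PW a.1 a.2 - ∏ i, (τ i).out πX (a.1 i) (a.2 i))
      have h5 : 1 ≤ (δ ^ N)⁻¹ * ∏ i, π (a.1 i, a.2 i) := by
        rw [inv_mul_eq_div, one_le_div (pow_pos hδ N)]
        exact h1
      beta_reduce at h3 h2
      linarith
  have hM : 1 ≤ 2 * (δ ^ N)⁻¹ := by
    have : 1 ≤ (δ ^ N)⁻¹ := (one_le_inv₀ (pow_pos hδ N)).2 (pow_le_one₀ hδ.le hδ1)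
    linarith
  refine (KL_le_of_sum_abs_sub_le (fun a => hP _ _) hQ hR hPR hQR hM hPM hη').trans
    (le_of_eq ?_)
  rw [Real.log_mul two_ne_zero (inv_ne_zero (pow_ne_zero _ hδ.ne')), Real.log_inv, Real.log_pow,
    mul_neg]
  congr 3
  rw [← e.sum_comp]
  exact sum_prod_mul_log_div (fun i => (τ i).out_isDist hX) hτ

end

section
variable {W X Y B U : Type} [Fintype W] [Fintype X] [Fintype Y] [Fintype B] [Fintype U]
  {n₀ n : ℕ}

/-- Error incurred when the randomness of a block is hashed into the state of the next block. -/
def hashError (PW : W → ℝ) (πX : X → ℝ) (t θ : ℝ) (τ : Fin n₀ → TestChannel X Y B U)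
    (τ' : Fin n → TestChannel X Y B U) : ℝ :=
  √θ + 2 * θ ^ (-t) * ((∏ i, (∑ w, PW w * PW w ^ t) * (τ i).moment πX t) *
    ∏ i, (τ' i).stateMoment t)

/-- Chain a first block with `L` copies of a second one. -/
lemma SeqCode.exists_chain {PW : W → ℝ} {πX : X → ℝ} (hW : IsDist PW) (hX : IsDist πX)
    {τ₀ : Fin n₀ → TestChannel X Y B U} {τ : Fin n → TestChannel X Y B U} {s₀ : Fin n₀ → U}
    (hs₀ : ∀ u, ∏ i, (τ₀ i).pU (u i) = if s₀ = u then 1 else 0) {t θ : ℝ} (ht : 0 ≤ t)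
    (hθ : 0 < θ) (L : ℕ) :
    ∃ (N : ℕ) (C : SeqCode W X Y B N) (st : (Fin N → W) → (Fin N → B) → (Fin n → U))
      (τ' : Fin N → TestChannel X Y B U), N = n₀ + L * n ∧
      (∀ f : TestChannel X Y B U → ℝ, ∑ i, f (τ' i) = ∑ i, f (τ₀ i) + L * ∑ i, f (τ i)) ∧
      (∀ P : TestChannel X Y B U → Prop, (∀ i, P (τ₀ i)) → (∀ i, P (τ i)) → ∀ i, P (τ' i)) ∧
      C.IsApprox PW πX st τ' (fun u => ∏ i, (τ i).pU (u i))
        (hashError PW πX t θ τ₀ τ + L * hashError PW πX t θ τ τ) := by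
  have hp : IsDist (fun u : Fin n → U => ∏ i, (τ i).pU (u i)) := IsDist.pi fun i => (τ i).pU_dist
  induction L with
  | zero =>
    obtain ⟨C, st, h⟩ := exists_isApprox_zero (W := W) (B := B) (Y := Y) (U := U) PW πX s₀
      Fin.elim0 (p := fun u => ∏ i, (τ₀ i).pU (u i)) (fun u => by rw [hs₀ u]; congr)
    obtain ⟨C', st', h'⟩ := h.exists_append hW hX hp ht hθ
    refine ⟨0 + n₀, C', st', Fin.append Fin.elim0 τ₀, by simp, fun f => ?_, fun P h0 _ i => ?_, ?_⟩
    rotate_left 2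
    · rw [sum_pi_stateMoment] at h'
      convert h' using 1
      simp [hashError]
    · rw [Fin.sum_univ_add]
      simp
    · refine Fin.addCases (fun i => i.elim0) (fun i => ?_) i
      rw [Fin.append_right]
      exact h0 i
  | succ L ih =>
    obtain ⟨N, C, st, τ', hN, hf, hP, h⟩ := ih
    obtain ⟨C', st', h'⟩ := h.exists_append hW hX hp ht hθ
    refine ⟨N + n, C', st', Fin.append τ' τ, by rw [hN]; ring, fun f => ?_, fun P h0 h1 i => ?_, ?_⟩
    · simp only [Fin.sum_univ_add, Fin.append_left, Fin.append_right, hf]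
      push_cast
      ring
    · refine Fin.addCases (fun i => ?_) (fun i => ?_) i
      · rw [Fin.append_left]
        exact hP P h0 h1 i
      · rw [Fin.append_right]
        exact h1 i
    · rw [sum_pi_stateMoment] at h'
      convert h' using 1
      simp only [hashError]
      push_cast
      ring

end

lemma hasDerivAt_mul_rpow_zero {a c : ℝ} (h : a ≠ 0 → 0 < c) :
    HasDerivAt (fun t : ℝ => a * c ^ t) (a * Real.log c) 0 := by
  by_cases ha : a = 0
  · simpa [ha] using hasDerivAt_const (0 : ℝ) (0 : ℝ)
  · simpa using ((Real.hasStrictDerivAt_const_rpow (h ha) 0).hasDerivAt).const_mul a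

lemma hasDerivAt_mul_rpow_neg_zero {a c : ℝ} (h : a ≠ 0 → 0 < c) :
    HasDerivAt (fun t : ℝ => a * c ^ (-t)) (-(a * Real.log c)) 0 := by
  have h0 : HasDerivAt (fun t : ℝ => a * c ^ t) (a * Real.log c) (-(0 : ℝ)) := by
    rw [neg_zero]; exact hasDerivAt_mul_rpow_zero h
  simpa [Function.comp_def] using h0.comp (0 : ℝ) (hasDerivAt_neg (0 : ℝ))

lemma eventually_lt_of_hasDerivAt_neg {f : ℝ → ℝ} {f' : ℝ} (h : HasDerivAt f f' 0) (hf' : f' < 0) :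
    ∀ᶠ t in nhdsWithin 0 (Set.Ioi 0), f t < f 0 := by
  have h1 := (hasDerivAt_iff_tendsto_slope.1 h).eventually (gt_mem_nhds hf')
  have h2 : ∀ᶠ t in nhdsWithin (0 : ℝ) (Set.Ioi 0), slope f 0 t < 0 :=
    h1.filter_mono (nhdsWithin_mono _ fun t ht => ne_of_gt ht)
  filter_upwards [h2, self_mem_nhdsWithin] with t ht ht0
  rw [slope_def_field, sub_zero] at ht
  have := (div_neg_iff.1 ht)
  have ht0' : 0 < t := ht0
  rcases this with ⟨_, h⟩ | ⟨h, _⟩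
  · linarith
  · linarith

section
variable {W X Y B U : Type} [Fintype W] [Fintype X] [Fintype Y] [Fintype B] [Fintype U]
namespace TestChannel

/-- Rate at which the state consumes randomness, minus the rate at which fresh randomness is
created. -/
def slack (c : TestChannel X Y B U) (PW : W → ℝ) (πX : X → ℝ) : ℝ :=
  ∑ w, PW w * Real.log (PW w) +
    ∑ x, ∑ y, ∑ b, ∑ u, c.joint πX x y b u * Real.log (c.joint πX x y b u / c.out πX x y) -
    ∑ u, c.pU u * Real.log (c.pU u)

/-- Contribution of a letter to the hashing error. -/
def factor (c : TestChannel X Y B U) (PW : W → ℝ) (πX : X → ℝ) (t : ℝ) : ℝ :=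
  (∑ w, PW w * PW w ^ t) * c.moment πX t * c.stateMoment t

variable {PW : W → ℝ} {πX : X → ℝ}

lemma factor_zero (hW : IsDist PW) (hX : IsDist πX) (c : TestChannel X Y B U) :
    c.factor PW πX 0 = 1 := by
  simp [factor, moment, stateMoment, hW.2, c.sum_joint hX, c.pU_dist.2]

lemma hasDerivAt_factor (hW : IsDist PW) (hX : IsDist πX) (c : TestChannel X Y B U) :
    HasDerivAt (c.factor PW πX) (c.slack PW πX) 0 := by
  have h1 : HasDerivAt (fun t : ℝ => ∑ w, PW w * PW w ^ t) (∑ w, PW w * Real.log (PW w)) 0 :=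
    HasDerivAt.fun_sum fun w _ => hasDerivAt_mul_rpow_zero fun h =>
      lt_of_le_of_ne (hW.1 w) (Ne.symm h)
  have h2 : HasDerivAt (c.moment πX) (∑ x, ∑ y, ∑ b, ∑ u,
      c.joint πX x y b u * Real.log (c.joint πX x y b u / c.out πX x y)) 0 :=
    HasDerivAt.fun_sum fun x _ => HasDerivAt.fun_sum fun y _ => HasDerivAt.fun_sum fun b _ =>
      HasDerivAt.fun_sum fun u _ => hasDerivAt_mul_rpow_zero fun h => by
        have h0 := lt_of_le_of_ne (c.joint_nonneg hX x y b u) (Ne.symm h)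
        exact div_pos h0 (h0.trans_le (c.joint_le_out hX _ _ _ _))
  have h3 : HasDerivAt c.stateMoment (∑ u, -(c.pU u * Real.log (c.pU u))) 0 :=
    HasDerivAt.fun_sum fun u _ => hasDerivAt_mul_rpow_neg_zero fun h =>
      lt_of_le_of_ne (c.pU_dist.1 u) (Ne.symm h)
  have h := (h1.mul h2).mul h3
  refine h.congr_deriv ?_
  simp only [Pi.mul_apply, moment, stateMoment, neg_zero, Real.rpow_zero, mul_one, hW.2,
    c.sum_joint hX, c.pU_dist.2, one_mul, slack, Finset.sum_neg_distrib]
  ring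

lemma moment_nonneg (hX : IsDist πX) (c : TestChannel X Y B U) (t : ℝ) : 0 ≤ c.moment πX t :=
  Finset.sum_nonneg fun _ _ => Finset.sum_nonneg fun _ _ => Finset.sum_nonneg fun _ _ =>
    Finset.sum_nonneg fun _ _ => mul_nonneg (c.joint_nonneg hX _ _ _ _)
      (Real.rpow_nonneg (div_nonneg (c.joint_nonneg hX _ _ _ _) (c.out_nonneg hX _ _)) _)

omit [Fintype X] in
lemma stateMoment_nonneg (c : TestChannel X Y B U) (t : ℝ) : 0 ≤ c.stateMoment t :=
  Finset.sum_nonneg fun _ _ => mul_nonneg (c.pU_dist.1 _) (Real.rpow_nonneg (c.pU_dist.1 _) _)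

omit [Fintype X] in
lemma stateMoment_eq_one {c : TestChannel X Y B U} {u₀ : U}
    (h : ∀ u, c.pU u = if u₀ = u then 1 else 0) (t : ℝ) : c.stateMoment t = 1 := by
  rw [stateMoment, Finset.sum_eq_single u₀ (fun u _ hu => by rw [h, if_neg hu.symm, zero_mul])
    (by simp), h, if_pos rfl, Real.one_rpow, one_mul]

end TestChannel

open TestChannel

variable {PW : W → ℝ} {πX : X → ℝ}

lemma eventually_prod_factor_lt_one (hW : IsDist PW) (hX : IsDist πX) {n : ℕ}
    (κ : Fin n → TestChannel X Y B U) (h : ∑ i, (κ i).slack PW πX < 0) :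
    ∀ᶠ t in nhdsWithin 0 (Set.Ioi 0), ∏ i, (κ i).factor PW πX t < 1 := by
  have h1 : HasDerivAt (fun t => ∏ i, (κ i).factor PW πX t) (∑ i, (κ i).slack PW πX) 0 := by
    refine (HasDerivAt.fun_finsetProd (u := Finset.univ)
      fun i _ => (κ i).hasDerivAt_factor hW hX).congr_deriv ?_
    simp [factor_zero hW hX]
  simpa [factor_zero hW hX] using eventually_lt_of_hasDerivAt_neg h1 h

lemma sum_mul_rpow_nonneg (hW : IsDist PW) (t : ℝ) : 0 ≤ ∑ w, PW w * PW w ^ t :=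
  Finset.sum_nonneg fun _ _ => mul_nonneg (hW.1 _) (Real.rpow_nonneg (hW.1 _) _)

lemma hashError_le {n₀ n : ℕ} {t θ : ℝ} (ht : t ≤ 1 / 2) (hθ : 0 < θ)
    (hθ1 : θ ≤ 1) {τ : Fin n₀ → TestChannel X Y B U} {τ' : Fin n → TestChannel X Y B U}
    (h : (∏ i, (∑ w, PW w * PW w ^ t) * (τ i).moment πX t) * ∏ i, (τ' i).stateMoment t ≤ θ) :
    hashError PW πX t θ τ τ' ≤ 3 * √θ := by
  have h1 : θ ^ (-t) * θ ≤ √θ := by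
    rw [Real.sqrt_eq_rpow]
    calc θ ^ (-t) * θ = θ ^ (-t + 1) := (Real.rpow_add_one hθ.ne' _).symm
      _ ≤ θ ^ (1 / 2 : ℝ) := Real.rpow_le_rpow_of_exponent_ge hθ hθ1 (by linarith)
  have h2 := mul_le_mul_of_nonneg_left h (Real.rpow_nonneg hθ.le (-t))
  rw [hashError, mul_assoc]
  linarith

/-- Concatenation of `r` copies of a word. -/
def repeatWord {n : ℕ} {α : Type} (r : ℕ) (κ : Fin n → α) (i : Fin (r * n)) : α :=
  κ (finProdFinEquiv.symm i).2

lemma prod_repeatWord {n : ℕ} {α : Type} (r : ℕ) (κ : Fin n → α) (f : α → ℝ) :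
    ∏ i, f (repeatWord r κ i) = (∏ i, f (κ i)) ^ r := by
  rw [← finProdFinEquiv.prod_comp, Fintype.prod_prod_type]
  simp [repeatWord]

lemma sum_repeatWord {n : ℕ} {α : Type} (r : ℕ) (κ : Fin n → α) (f : α → ℝ) :
    ∑ i, f (repeatWord r κ i) = r * ∑ i, f (κ i) := by
  rw [← finProdFinEquiv.sum_comp, Fintype.sum_prod_type]
  simp [repeatWord]

lemma exists_nat_numerics {γ : ℝ} (hγ : 0 < γ) (hγ1 : γ < 1) (A B C : ℝ) :
    ∃ r : ℕ, 1 ≤ r ∧ A * √(γ ^ r) ≤ 1 ∧ (B + r * C) * (A * √(γ ^ r)) + 1 ≤ r := by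
  have hs : ∀ r : ℕ, √(γ ^ r) = √γ ^ r := fun r => by
    rw [Real.sqrt_eq_rpow, Real.sqrt_eq_rpow, ← Real.rpow_natCast, ← Real.rpow_natCast,
      ← Real.rpow_mul hγ.le, ← Real.rpow_mul hγ.le, mul_comm]
  have hs1 : √γ < 1 := by rw [Real.sqrt_lt' one_pos]; simpa using hγ1
  have h1 := tendsto_pow_atTop_nhds_zero_of_lt_one (Real.sqrt_nonneg γ) hs1
  have h2 := tendsto_self_mul_const_pow_of_lt_one (Real.sqrt_nonneg γ) hs1
  have h3 := h1.const_mul A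
  have h4 := (h1.const_mul (B * A)).add (h2.const_mul (C * A))
  rw [mul_zero] at h3
  rw [mul_zero, mul_zero, add_zero] at h4
  obtain ⟨r, hr1, hr2, hr3⟩ := ((h3.eventually (gt_mem_nhds one_pos)).and
    ((h4.eventually (gt_mem_nhds one_pos)).and (Filter.eventually_ge_atTop 2))).exists
  have hr : (2 : ℝ) ≤ r := by exact_mod_cast hr3
  refine ⟨r, by omega, ?_, ?_⟩
  · rw [hs]; exact hr1.le
  · rw [hs]
    nlinarith

/-- Codes with divergence rate close to the average divergence of a word of test channels. -/
lemma exists_code_of_word (hW : IsDist PW) (hX : IsDist πX) {π : X × Y → ℝ} (hπ : IsDist π)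
    {c₀ : TestChannel X Y B U} {u₀ : U} (hu₀ : ∀ u, c₀.pU u = if u₀ = u then 1 else 0)
    (hc₀ : c₀.slack PW πX < 0) (hc₀π : ∀ a, π a = 0 → c₀.out πX a.1 a.2 = 0)
    {n : ℕ} (hn : 0 < n) {κ : Fin n → TestChannel X Y B U} (hκ : ∑ i, (κ i).slack PW πX < 0)
    (hκπ : ∀ i a, π a = 0 → (κ i).out πX a.1 a.2 = 0) {ε : ℝ} (hε : 0 < ε) :
    ∃ N : ℕ, 1 ≤ N ∧ ∃ C : SeqCode W X Y B N,
      KL (fun p : (Fin N → X) × (Fin N → Y) => (∏ i, πX (p.1 i)) * C.channel PW p.1 p.2)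
        (fun p : (Fin N → X) × (Fin N → Y) => ∏ i, π (p.1 i, p.2 i)) ≤
      ENNReal.ofReal (N * ((∑ i, (κ i).div πX π) / n + ε)) := by
  obtain ⟨t, hκt, hc₀t, ht, ht0⟩ := ((eventually_prod_factor_lt_one hW hX κ hκ).and
    ((eventually_prod_factor_lt_one hW hX (fun _ : Fin 1 => c₀) (by simpa using hc₀)).and
    (((gt_mem_nhds (by norm_num : (0 : ℝ) < 1 / 2)).filter_mono nhdsWithin_le_nhds).and
      self_mem_nhdsWithin))).exists
  replace ht0 : 0 < t := ht0
  simp only [Finset.univ_unique, Finset.prod_const, Finset.card_singleton, pow_one, factor,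
    stateMoment_eq_one hu₀, mul_one] at hc₀t
  set a := (∑ w, PW w * PW w ^ t) * c₀.moment πX t with ha
  have ha0 : 0 ≤ a := mul_nonneg (sum_mul_rpow_nonneg hW t) (c₀.moment_nonneg hX t)
  set G := ∏ i, (κ i).stateMoment t with hG
  have hG0 : 0 ≤ G := Finset.prod_nonneg fun i _ => (κ i).stateMoment_nonneg t
  set F := ∏ i, (κ i).factor PW πX t with hF
  have hFe : (∏ i, (∑ w, PW w * PW w ^ t) * (κ i).moment πX t) * G = F := by
    rw [hG, hF, ← Finset.prod_mul_distrib]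
    rfl
  have hF0 : 0 ≤ F := by
    rw [← hFe]
    exact mul_nonneg (Finset.prod_nonneg fun i _ =>
      mul_nonneg (sum_mul_rpow_nonneg hW t) ((κ i).moment_nonneg hX t)) hG0
  obtain ⟨m, hm1, hm⟩ : ∃ m : ℕ, 1 ≤ m ∧ a ^ m * G < 1 := by
    have := (tendsto_pow_atTop_nhds_zero_of_lt_one ha0 hc₀t).mul_const G
    rw [zero_mul] at this
    obtain ⟨m, h1, h2⟩ := ((Filter.eventually_ge_atTop 1).and
      (this.eventually (gt_mem_nhds one_pos))).exists
    exact ⟨m, h1, h2⟩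
  obtain ⟨γ, hγ0, hγ1, hγa, hγF⟩ : ∃ γ : ℝ, 0 < γ ∧ γ < 1 ∧ a ^ m * G ≤ γ ∧ F ≤ γ :=
    ⟨max (1 / 2) (max (a ^ m * G) F), by positivity, by
      rw [max_lt_iff, max_lt_iff]; exact ⟨by norm_num, hm, hκt⟩,
      (le_max_left _ _).trans (le_max_right _ _), (le_max_right _ _).trans (le_max_right _ _)⟩
  obtain ⟨δ, hδ0, hδ1, hδ⟩ := exists_pos_le_of_ne_zero hπ
  set D := (∑ i, (κ i).div πX π) / n with hD
  have hn' : (0 : ℝ) < n := by exact_mod_cast hn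
  have hDn : ∑ i, (κ i).div πX π = n * D := by rw [hD]; field_simp
  obtain ⟨L, hL⟩ := exists_nat_ge ((m * (c₀.div πX π - D) + 1) / (n * ε))
  rw [div_le_iff₀ (by positivity)] at hL
  obtain ⟨r, hr1, hrη, hr⟩ := exists_nat_numerics hγ0 hγ1 ((1 + L) * 3) (1 + Real.log 2)
    ((m + L * n) * -Real.log δ)
  have hθ1 : γ ^ r ≤ 1 := pow_le_one₀ hγ0.le hγ1.le
  have hτ₀ : ∀ u : Fin (r * m) → U, ∏ i, (repeatWord r (fun _ : Fin m => c₀) i).pU (u i) =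
      if (fun _ => u₀) = u then 1 else 0 := by
    intro u
    simp only [repeatWord, hu₀, Finset.prod_ite_zero, Finset.prod_const_one, Finset.mem_univ,
      true_imp_iff, funext_iff]
  obtain ⟨N, C, st, τ, hN, hf, hP, h⟩ := SeqCode.exists_chain hW hX
    (τ := repeatWord r κ) hτ₀ ht0.le (pow_pos hγ0 r) L
  have e0 : hashError PW πX t (γ ^ r) (repeatWord r (fun _ : Fin m => c₀)) (repeatWord r κ) ≤
      3 * √(γ ^ r) := by
    refine hashError_le ht.le (pow_pos hγ0 r) hθ1 ?_
    rw [prod_repeatWord r (fun _ : Fin m => c₀) (fun c => (∑ w, PW w * PW w ^ t) * c.moment πX t),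
      prod_repeatWord r κ (fun c => c.stateMoment t), ← mul_pow]
    simp only [Finset.prod_const, Finset.card_univ, Fintype.card_fin]
    exact pow_le_pow_left₀ (mul_nonneg (pow_nonneg ha0 m) hG0) hγa r
  have e1 : hashError PW πX t (γ ^ r) (repeatWord r κ) (repeatWord r κ) ≤ 3 * √(γ ^ r) := by
    refine hashError_le ht.le (pow_pos hγ0 r) hθ1 ?_
    rw [prod_repeatWord r κ (fun c => (∑ w, PW w * PW w ^ t) * c.moment πX t),
      prod_repeatWord r κ (fun c => c.stateMoment t), ← mul_pow, hFe]
    exact pow_le_pow_left₀ hF0 hγF r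
  set η := hashError PW πX t (γ ^ r) (repeatWord r (fun _ : Fin m => c₀)) (repeatWord r κ) +
    L * hashError PW πX t (γ ^ r) (repeatWord r κ) (repeatWord r κ) with hη
  have hη1 : η ≤ (1 + L) * 3 * √(γ ^ r) := by
    have := mul_le_mul_of_nonneg_left e1 (Nat.cast_nonneg (α := ℝ) L)
    linarith
  have hNr : (N : ℝ) = r * (m + L * n) := by rw [hN]; push_cast; ring
  refine ⟨N, by rw [hN]; exact Nat.le_add_right_of_le (Nat.mul_le_mul hr1 hm1), C, ?_⟩
  have hKL := h.KL_le hW hπ hX hδ0 hδ1 hδ (IsDist.pi fun i => (repeatWord r κ i).pU_dist)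
    (hη1.trans hrη) (hP (fun c => ∀ a, π a = 0 → c.out πX a.1 a.2 = 0) (fun _ => hc₀π)
      fun i => hκπ _)
  refine hKL.trans (ENNReal.ofReal_le_ofReal ?_)
  rw [hf (fun c => c.div πX π), sum_repeatWord r (fun _ : Fin m => c₀) (fun c => c.div πX π),
    sum_repeatWord r κ (fun c => c.div πX π), hDn, hNr]
  simp only [Finset.sum_const, Finset.card_univ, Fintype.card_fin, nsmul_eq_mul]
  have hlδ : 0 ≤ -Real.log δ := neg_nonneg.2 (Real.log_nonpos hδ0.le hδ1)
  have hl2 : 0 ≤ Real.log 2 := Real.log_nonneg one_le_two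
  have h5 := mul_le_mul_of_nonneg_left hη1
    (by positivity : 0 ≤ 1 + (Real.log 2 + r * (m + L * n) * -Real.log δ))
  have hr0 : (0 : ℝ) ≤ r := Nat.cast_nonneg r
  have h6 := mul_le_mul_of_nonneg_left hL hr0
  have h7 : 0 ≤ (r : ℝ) * (m * ε) := by positivity
  linarith

end

lemma exists_word_of_counts {ι : Type} [Fintype ι] (k : ι → ℕ) :
    ∃ κ : Fin (∑ v, k v) → ι, ∀ f : ι → ℝ, ∑ i, f (κ i) = ∑ v, k v * f v := by
  have hc : Fintype.card (Σ v, Fin (k v)) = ∑ v, k v := by simp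
  refine ⟨fun i => ((Fintype.equivFinOfCardEq hc).symm i).1, fun f => ?_⟩
  rw [← (Fintype.equivFinOfCardEq hc).sum_comp, Fintype.sum_sigma]
  simp

/-- A finite word whose empirical averages approximate those of a distribution, with one letter
overrepresented so as to make a constraint strict. -/
lemma exists_word {ι : Type} [Fintype ι] {ω : ι → ℝ} (hω : IsDist ω) {μ D : ι → ℝ}
    (hμ : ∑ v, ω v * μ v ≤ 0) {v₀ : ι} (hv₀ : μ v₀ < 0) {ε : ℝ} (hε : 0 < ε) :
    ∃ (n : ℕ) (κ : Fin n → ι), 0 < n ∧ ∑ i, μ (κ i) < 0 ∧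
      (∑ i, D (κ i)) / n ≤ ∑ v, ω v * D v + ε := by
  obtain ⟨c, hc⟩ := exists_nat_gt ((∑ v, |μ v|) / -μ v₀)
  have hv₀' : 0 < -μ v₀ := neg_pos.2 hv₀
  have hc0 : (0 : ℝ) < c :=
    (div_nonneg (Finset.sum_nonneg fun _ _ => abs_nonneg _) hv₀'.le).trans_lt hc
  rw [div_lt_iff₀ hv₀'] at hc
  set m := ∑ v, ω v * D v with hm
  obtain ⟨M, hM⟩ := exists_nat_ge ((∑ v, |D v - m| + c * (D v₀ - m)) / ε)
  rw [div_le_iff₀ hε] at hM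
  set k : ι → ℕ := fun v => ⌈ω v * M⌉₊ + if v = v₀ then c else 0 with hk
  have hk_le : ∀ f : ι → ℝ,
      ∑ v, k v * f v ≤ M * ∑ v, ω v * f v + ∑ v, |f v| + c * f v₀ := by
    intro f
    have h1 : ∀ v, (k v : ℝ) * f v ≤ M * (ω v * f v) + |f v| +
        if v = v₀ then c * f v else 0 := by
      intro v
      have h2 := Nat.le_ceil (ω v * (M : ℝ))
      have h3 := Nat.ceil_lt_add_one (mul_nonneg (hω.1 v) (Nat.cast_nonneg M))
      have h4 : ((⌈ω v * (M : ℝ)⌉₊ : ℝ) - ω v * M) * f v ≤ |f v| := by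
        refine (le_abs_self _).trans ?_
        rw [abs_mul, abs_of_nonneg (sub_nonneg.2 h2)]
        exact mul_le_of_le_one_left (abs_nonneg _) (by linarith)
      simp only [hk]
      split_ifs <;> push_cast <;> linarith
    refine (Finset.sum_le_sum fun v _ => h1 v).trans (le_of_eq ?_)
    rw [Finset.sum_add_distrib, Finset.sum_add_distrib, ← Finset.mul_sum]
    simp
  obtain ⟨κ, hκ⟩ := exists_word_of_counts k
  have hcn : c ≤ ∑ v, k v := by
    refine le_trans ?_ (Finset.single_le_sum (fun v _ => Nat.zero_le (k v)) (Finset.mem_univ v₀))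
    simp [hk]
  have hMn : (M : ℝ) ≤ ((∑ v, k v : ℕ) : ℝ) := by
    push_cast
    calc (M : ℝ) = ∑ v, ω v * M := by rw [← Finset.sum_mul, hω.2, one_mul]
      _ ≤ _ := Finset.sum_le_sum fun v _ => (Nat.le_ceil _).trans
        (Nat.cast_le.2 (Nat.le_add_right _ _))
  have hn : 0 < ∑ v, k v := lt_of_lt_of_le (by exact_mod_cast hc0) hcn
  have hn' : (0 : ℝ) < ((∑ v, k v : ℕ) : ℝ) := by exact_mod_cast hn
  refine ⟨_, κ, hn, ?_, ?_⟩
  · rw [hκ]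
    have := hk_le μ
    have := mul_nonpos_of_nonneg_of_nonpos (Nat.cast_nonneg (α := ℝ) M) hμ
    linarith
  · rw [div_le_iff₀ hn']
    have h1 := hk_le fun v => D v - m
    simp only [← hκ, mul_sub, Finset.sum_sub_distrib, ← hm] at h1
    rw [← Finset.sum_mul, hω.2, Finset.sum_const, Finset.card_univ, Fintype.card_fin,
      nsmul_eq_mul] at h1
    have h2 := mul_le_mul_of_nonneg_left hMn hε.le
    linarith

section
variable {α β γ : Type} [Fintype α] [Fintype β] [Fintype γ]

lemma marg_eq_sum (e : β × γ ≃ α) {f : α → β} (h : ∀ b c, f (e (b, c)) = b) (p : α → ℝ) (b : β) :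
    marg f p b = ∑ c, p (e (b, c)) := by
  rw [marg, ← e.sum_comp, Fintype.sum_prod_type, Finset.sum_eq_single b]
  · simp [h]
  · intro b' _ hb
    simp [h, hb]
  · simp

lemma ent_marg (f : α → β) (p : α → ℝ) :
    ent (marg f p) = -∑ a, p a * Real.log (marg f p (f a)) := by
  have h : ∀ b, marg f p b * Real.log (marg f p b) =
      ∑ a, if f a = b then p a * Real.log (marg f p (f a)) else 0 := by
    intro b
    conv_lhs => rw [marg, Finset.sum_mul]
    refine Finset.sum_congr rfl fun a _ => ?_
    split_ifs with hab
    · rw [← hab]; rfl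
    · rw [zero_mul]
  simp only [ent, Real.negMulLog, neg_mul, Finset.sum_neg_distrib, h]
  rw [Finset.sum_comm]
  simp

lemma IsDist.marg {p : α → ℝ} (hp : IsDist p) (f : α → β) : IsDist (marg f p) := by
  refine ⟨fun b => Finset.sum_nonneg fun a _ => ?_, ?_⟩
  · split_ifs
    · exact hp.1 a
    · exact le_rfl
  · simp only [_root_.marg]
    rw [Finset.sum_comm]
    simpa using hp.2

end

section
variable {X Y B U V W : Type} [Fintype X] [Fintype Y] [Fintype B] [Fintype U] [Fintype V]
  [Fintype W]

/-- The test channel with deterministic state and output and a uniform message. -/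
def TestChannel.uniform [Nonempty B] (u₀ : U) (y₀ : Y) : TestChannel X Y B U where
  pU u := if u₀ = u then 1 else 0
  pB _ _ _ := (Fintype.card B : ℝ)⁻¹
  pY _ _ y := if y₀ = y then 1 else 0
  pU_dist := ⟨fun _ => by dsimp only; split_ifs <;> norm_num, by simp⟩
  pB_dist _ _ := ⟨fun _ => by positivity, by simp⟩
  pY_dist _ _ := ⟨fun _ => by dsimp only; split_ifs <;> norm_num, by simp⟩

omit [Fintype X] in
lemma TestChannel.uniform_out [Nonempty B] (u₀ : U) (y₀ : Y) (πX : X → ℝ) (x : X) (y : Y) :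
    (uniform (B := B) u₀ y₀).out πX x y = πX x * if y₀ = y then 1 else 0 := by
  have h : (Fintype.card B : ℝ) ≠ 0 := by simp
  simp only [out, joint, uniform, ← Finset.sum_mul]
  rw [Finset.sum_comm]
  simp [mul_assoc]
  split_ifs <;> field_simp

lemma sum_mul_log_nonpos {p : W → ℝ} (hp : IsDist p) : ∑ w, p w * Real.log (p w) ≤ 0 :=
  Finset.sum_nonpos fun w _ => mul_nonpos_of_nonneg_of_nonpos (hp.1 w)
    (Real.log_nonpos (hp.1 w) (hp.le_one w))

lemma TestChannel.uniform_slack_neg [Nonempty B] (hB : 2 ≤ Fintype.card B) (u₀ : U) (y₀ : Y)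
    {PW : W → ℝ} (hW : IsDist PW) {πX : X → ℝ} (hX : IsDist πX) :
    (uniform (B := B) u₀ y₀).slack PW πX < 0 := by
  set c : TestChannel X Y B U := uniform u₀ y₀ with hc
  have h1 : ∑ u, c.pU u * Real.log (c.pU u) = 0 :=
    Finset.sum_eq_zero fun u _ => by
      simp only [hc, uniform]
      split_ifs <;> simp
  have h2 : ∀ x y b u, c.joint πX x y b u * Real.log (c.joint πX x y b u / c.out πX x y) =
      c.joint πX x y b u * -Real.log (Fintype.card B) := by
    intro x y b u
    rw [hc, uniform_out]
    simp only [joint, uniform]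
    split_ifs
    · by_cases hx : πX x = 0
      · simp [hx]
      · rw [← Real.log_inv]
        congr 2
        field_simp
    all_goals simp
  have h3 := Real.log_pos (by exact_mod_cast hB : (1 : ℝ) < Fintype.card B)
  simp only [slack, h1, h2, ← Finset.sum_mul]
  rw [c.sum_joint hX]
  have := sum_mul_log_nonpos hW
  linarith

lemma sum_quintuple (F : X × U × V × B × Y → ℝ) :
    ∑ q, F q = ∑ v, ∑ x, ∑ y, ∑ b, ∑ u, F (x, u, v, b, y) := by
  let e : V × X × Y × B × U ≃ X × U × V × B × Y :=
    ⟨fun q => (q.2.1, q.2.2.2.2, q.1, q.2.2.2.1, q.2.2.1),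
      fun q => (q.2.2.1, q.1, q.2.2.2.2, q.2.2.2.1, q.2.1), fun _ => rfl, fun _ => rfl⟩
  rw [← e.sum_comp]
  simp only [Fintype.sum_prod_type]
  rfl

/-- A family of test channels conditionally on the time-sharing variable. -/
structure IsDisintegration (c : V → TestChannel X Y B U) (PUV : U × V → ℝ)
    (PB : X × U × V → B → ℝ) (PY : B × U × V → Y → ℝ) : Prop where
  pU_eq : ∀ u v, marg Prod.snd PUV v * (c v).pU u = PUV (u, v)
  joint_eq : ∀ πX x u v b y, marg Prod.snd PUV v * (c v).joint πX x y b u =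
    seqJoint πX PUV PB PY (x, u, v, b, y)

lemma marg_snd (PUV : U × V → ℝ) (v : V) : marg Prod.snd PUV v = ∑ u, PUV (u, v) :=
  marg_eq_sum (Equiv.prodComm V U) (fun _ _ => rfl) PUV v

omit [Fintype X] in
lemma exists_disintegration {PUV : U × V → ℝ} {PB : X × U × V → B → ℝ}
    {PY : B × U × V → Y → ℝ} (hUV : IsDist PUV) (hPB : IsKernel PB) (hPY : IsKernel PY)
    (c₀ : TestChannel X Y B U) :
    ∃ c : V → TestChannel X Y B U, IsDisintegration c PUV PB PY ∧
      ∀ v, marg Prod.snd PUV v = 0 → c v = c₀ := by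
  have h0 : ∀ v, marg Prod.snd PUV v = 0 → ∀ u, PUV (u, v) = 0 := fun v hv u => by
    rw [marg_snd] at hv
    exact (Finset.sum_eq_zero_iff_of_nonneg fun u _ => hUV.1 _).1 hv u (Finset.mem_univ u)
  let c : V → TestChannel X Y B U := fun v =>
    if hv : marg Prod.snd PUV v = 0 then c₀ else
      { pU := fun u => PUV (u, v) / marg Prod.snd PUV v
        pB := fun u x => PB (x, u, v)
        pY := fun u b => PY (b, u, v)
        pU_dist := ⟨fun u => div_nonneg (hUV.1 _) ((hUV.marg Prod.snd).1 v), by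
          rw [← Finset.sum_div, ← marg_snd, div_self hv]⟩
        pB_dist := fun u x => hPB _
        pY_dist := fun u b => hPY _ }
  refine ⟨c, ⟨fun u v => ?_, fun πX x u v b y => ?_⟩, fun v hv => by simp only [c, dif_pos hv]⟩
  · by_cases hv : marg Prod.snd PUV v = 0
    · rw [hv, zero_mul, h0 v hv]
    · simp only [c, dif_neg hv]
      field_simp
  · by_cases hv : marg Prod.snd PUV v = 0
    · rw [hv, zero_mul, seqJoint]
      simp [h0 v hv]
    · simp only [c, dif_neg hv, TestChannel.joint, seqJoint]
      field_simp

namespace IsDisintegration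
variable {c : V → TestChannel X Y B U} {PUV : U × V → ℝ} {PB : X × U × V → B → ℝ}
  {PY : B × U × V → Y → ℝ} {πX : X → ℝ} {PW : W → ℝ}

lemma marg_xvy (h : IsDisintegration c PUV PB PY) (r : X × V × Y) :
    marg (fun q : X × U × V × B × Y => (q.1, q.2.2.1, q.2.2.2.2)) (seqJoint πX PUV PB PY) r =
      marg Prod.snd PUV r.2.1 * (c r.2.1).out πX r.1 r.2.2 := by
  let e : (X × V × Y) × (B × U) ≃ X × U × V × B × Y :=
    ⟨fun q => (q.1.1, q.2.2, q.1.2.1, q.2.1, q.1.2.2),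
      fun q => ((q.1, q.2.2.1, q.2.2.2.2), (q.2.2.2.1, q.2.1)), fun _ => rfl, fun _ => rfl⟩
  rw [marg_eq_sum e (fun _ _ => rfl), Fintype.sum_prod_type]
  simp only [TestChannel.out, Finset.mul_sum, h.joint_eq]
  rfl

lemma marg_xyv (h : IsDisintegration c PUV PB PY) (x : X) (y : Y) (v : V) :
    marg (fun q : X × U × V × B × Y => (q.1, q.2.2.2.2, q.2.2.1)) (seqJoint πX PUV PB PY) (x, y, v) =
      marg Prod.snd PUV v * (c v).out πX x y := by
  let e : (X × Y × V) × (B × U) ≃ X × U × V × B × Y :=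
    ⟨fun q => (q.1.1, q.2.2, q.1.2.2, q.2.1, q.1.2.1),
      fun q => ((q.1, q.2.2.2.2, q.2.2.1), (q.2.2.2.1, q.2.1)), fun _ => rfl, fun _ => rfl⟩
  rw [marg_eq_sum e (fun _ _ => rfl), Fintype.sum_prod_type]
  simp only [TestChannel.out, Finset.mul_sum, h.joint_eq]
  rfl

lemma marg_all (x : X) (u : U) (v : V) (b : B) (y : Y) :
    marg (fun q : X × U × V × B × Y => ((q.2.2.2.1, q.2.1), (q.1, q.2.2.2.2, q.2.2.1)))
      (seqJoint πX PUV PB PY) ((b, u), (x, y, v)) = seqJoint πX PUV PB PY (x, u, v, b, y) := by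
  let e : ((B × U) × (X × Y × V)) × Unit ≃ X × U × V × B × Y :=
    ⟨fun q => (q.1.2.1, q.1.1.2, q.1.2.2.2, q.1.1.1, q.1.2.2.1),
      fun q => (((q.2.2.2.1, q.2.1), (q.1, q.2.2.2.2, q.2.2.1)), ()), fun _ => rfl, fun _ => rfl⟩
  rw [marg_eq_sum e (fun _ _ => rfl)]
  simp [e]

lemma marg_uv (h : IsDisintegration c PUV PB PY) (hX : IsDist πX) (u : U) (v : V) :
    marg (fun q : X × U × V × B × Y => (q.2.1, q.2.2.1)) (seqJoint πX PUV PB PY) (u, v) =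
      PUV (u, v) := by
  let e : (U × V) × (X × B × Y) ≃ X × U × V × B × Y :=
    ⟨fun q => (q.2.1, q.1.1, q.1.2, q.2.2.1, q.2.2.2),
      fun q => ((q.2.1, q.2.2.1), (q.1, q.2.2.2.1, q.2.2.2.2)), fun _ => rfl, fun _ => rfl⟩
  rw [marg_eq_sum e (fun _ _ => rfl)]
  simp only [Fintype.sum_prod_type, e, Equiv.coe_fn_mk, ← h.joint_eq, TestChannel.joint,
    ← Finset.mul_sum, ((c v).pY_dist _ _).2, ((c v).pB_dist _ _).2, hX.2, mul_one, h.pU_eq]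

lemma marg_v (h : IsDisintegration c PUV PB PY) (hX : IsDist πX) (v : V) :
    marg (fun q : X × U × V × B × Y => q.2.2.1) (seqJoint πX PUV PB PY) v =
      marg Prod.snd PUV v := by
  let e : V × (X × Y × B × U) ≃ X × U × V × B × Y :=
    ⟨fun q => (q.2.1, q.2.2.2.2, q.1, q.2.2.2.1, q.2.2.1),
      fun q => (q.2.2.1, q.1, q.2.2.2.2, q.2.2.2.1, q.2.1), fun _ => rfl, fun _ => rfl⟩
  rw [marg_eq_sum e (fun _ _ => rfl)]
  simp only [Fintype.sum_prod_type, e, Equiv.coe_fn_mk, ← h.joint_eq, ← Finset.mul_sum,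
    (c v).sum_joint hX, mul_one]

/-- The entropy constraint says that the average slack is nonpositive. -/
lemma sum_slack_eq (h : IsDisintegration c PUV PB PY) (hUV : IsDist PUV) (hX : IsDist πX) :
    ∑ v, marg Prod.snd PUV v * (c v).slack PW πX =
      condEnt (fun q : X × U × V × B × Y => q.2.1) (fun q => q.2.2.1) (seqJoint πX PUV PB PY) -
      (condEnt (fun q : X × U × V × B × Y => (q.2.2.2.1, q.2.1))
        (fun q => (q.1, q.2.2.2.2, q.2.2.1)) (seqJoint πX PUV PB PY) + ent PW) := by
  have hP := hUV.marg (Prod.snd : U × V → V)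
  have hW : ent PW = -∑ w, PW w * Real.log (PW w) := by
    simp [ent, Real.negMulLog]
  have key : ∀ v x y b u, marg Prod.snd PUV v * (c v).joint πX x y b u *
      (Real.log (marg Prod.snd PUV v * (c v).joint πX x y b u) -
        Real.log (marg Prod.snd PUV v * (c v).out πX x y) -
        Real.log (marg Prod.snd PUV v * (c v).pU u) + Real.log (marg Prod.snd PUV v)) =
      marg Prod.snd PUV v * ((c v).joint πX x y b u *
        Real.log ((c v).joint πX x y b u / (c v).out πX x y) -
        (c v).joint πX x y b u * Real.log ((c v).pU u)) := by
    intro v x y b u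
    by_cases hv : marg Prod.snd PUV v = 0
    · simp [hv]
    by_cases hj : (c v).joint πX x y b u = 0
    · simp [hj]
    have ho : (c v).out πX x y ≠ 0 :=
      ((lt_of_le_of_ne ((c v).joint_nonneg hX x y b u) (Ne.symm hj)).trans_le
        ((c v).joint_le_out hX _ _ _ _)).ne'
    have hu : (c v).pU u ≠ 0 := by
      intro hu
      exact hj (by simp [TestChannel.joint, hu])
    rw [Real.log_mul hv hj, Real.log_mul hv ho, Real.log_mul hv hu, Real.log_div hj ho]
    ring
  have hs : ∀ v, marg Prod.snd PUV v * (c v).slack PW πX =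
      marg Prod.snd PUV v * ∑ w, PW w * Real.log (PW w) +
      ∑ x, ∑ y, ∑ b, ∑ u, marg Prod.snd PUV v * ((c v).joint πX x y b u *
        Real.log ((c v).joint πX x y b u / (c v).out πX x y) -
        (c v).joint πX x y b u * Real.log ((c v).pU u)) := by
    intro v
    rw [TestChannel.slack, ← (c v).sum_joint_mul hX]
    simp only [← Finset.mul_sum, Finset.sum_sub_distrib]
    ring
  simp only [hs, ← key, Finset.sum_add_distrib, ← Finset.sum_mul, hP.2, one_mul, hW]
  rw [condEnt, condEnt, ent_marg, ent_marg, ent_marg, ent_marg]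
  simp only [sum_quintuple, h.marg_xyv, marg_all, h.marg_uv hX, h.marg_v hX, ← h.joint_eq,
    ← h.pU_eq, mul_add, mul_sub, Finset.sum_add_distrib, Finset.sum_sub_distrib]
  ring

end IsDisintegration
end

section
variable {X Y B U V W : Type} [Fintype X] [Fintype Y] [Fintype B] [Fintype U] [Fintype V]
  [Fintype W]

namespace IsDisintegration
variable {c : V → TestChannel X Y B U} {PUV : U × V → ℝ} {PB : X × U × V → B → ℝ}
  {PY : B × U × V → Y → ℝ} {πX : X → ℝ} {π : X × Y → ℝ}

lemma out_eq_zero_of_KL_ne_top (h : IsDisintegration c PUV PB PY)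
    (hKL : KL (marg (fun q : X × U × V × B × Y => (q.1, q.2.2.1, q.2.2.2.2))
      (seqJoint πX PUV PB PY)) (fun r : X × V × Y => marg Prod.snd PUV r.2.1 * π (r.1, r.2.2)) ≠ ⊤)
    {v : V} (hv : marg Prod.snd PUV v ≠ 0) (a : X × Y) (ha : π a = 0) :
    (c v).out πX a.1 a.2 = 0 := by
  have hac := not_not.1 fun h0 => hKL (if_neg h0)
  have := hac (a.1, v, a.2) (by simp [ha])
  rw [h.marg_xvy] at this
  exact (mul_eq_zero.1 this).resolve_left hv

lemma KL_eq (h : IsDisintegration c PUV PB PY)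
    (hKL : KL (marg (fun q : X × U × V × B × Y => (q.1, q.2.2.1, q.2.2.2.2))
      (seqJoint πX PUV PB PY)) (fun r : X × V × Y => marg Prod.snd PUV r.2.1 * π (r.1, r.2.2)) ≠ ⊤) :
    KL (marg (fun q : X × U × V × B × Y => (q.1, q.2.2.1, q.2.2.2.2))
      (seqJoint πX PUV PB PY)) (fun r : X × V × Y => marg Prod.snd PUV r.2.1 * π (r.1, r.2.2)) =
    ENNReal.ofReal (∑ v, marg Prod.snd PUV v * (c v).div πX π) := by
  rw [KL] at hKL ⊢
  split_ifs at hKL ⊢ with hac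
  · congr 1
    simp only [h.marg_xvy, Fintype.sum_prod_type, TestChannel.div, Finset.mul_sum]
    rw [Finset.sum_comm]
    refine Finset.sum_congr rfl fun v _ => Finset.sum_congr rfl fun x _ =>
      Finset.sum_congr rfl fun y _ => ?_
    by_cases hv : marg Prod.snd PUV v = 0
    · simp [hv]
    · rw [mul_div_mul_left _ _ hv, mul_assoc]
  · exact absurd rfl hKL

end IsDisintegration

/-- Every feasible value is achieved up to an arbitrarily small loss. -/
lemma exists_code_of_mem_psiSet {PW : W → ℝ} (hPW : IsDist PW) {π : X × Y → ℝ} (hπ : IsDist π)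
    (hB : 2 ≤ Fintype.card B) {y₀ : Y} (hy₀ : ∀ x : X, 0 < marg Prod.fst π x → 0 < π (x, y₀))
    {d : ℝ≥0∞} (hd : d ∈ psiSet X Y B π (ent PW)) (hd' : d ≠ ⊤) {ε : ℝ} (hε : 0 < ε) :
    ∃ n : ℕ, 1 ≤ n ∧ ∃ C : SeqCode W X Y B n,
      KL (fun p : (Fin n → X) × (Fin n → Y) =>
          (∏ i, marg Prod.fst π (p.1 i)) * C.channel PW p.1 p.2)
        (fun p : (Fin n → X) × (Fin n → Y) => ∏ i, π (p.1 i, p.2 i)) / (n : ℝ≥0∞) ≤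
      d + ENNReal.ofReal ε := by
  obtain ⟨m, l, PUV, PB, PY, hUV, hPB, hPY, hent, rfl⟩ := hd
  have hX : IsDist (marg Prod.fst π) := hπ.marg _
  have : Nonempty B := Fintype.card_pos_iff.1 (by omega)
  obtain ⟨u₀⟩ : Nonempty (Fin m) := by
    by_contra hne
    rw [not_nonempty_iff] at hne
    have := hUV.2
    simp at this
  set c₀ : TestChannel X Y B (Fin m) := TestChannel.uniform u₀ y₀ with hc₀
  have hc₀s : c₀.slack PW (marg Prod.fst π) < 0 :=
    TestChannel.uniform_slack_neg hB u₀ y₀ hPW hX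
  have hc₀π : ∀ a, π a = 0 → c₀.out (marg Prod.fst π) a.1 a.2 = 0 := by
    rintro ⟨x, y⟩ ha
    rw [hc₀, TestChannel.uniform_out]
    split_ifs with h
    · subst h
      have : marg Prod.fst π x = 0 :=
        le_antisymm (not_lt.1 fun h => (hy₀ x h).ne' ha) (hX.1 x)
      rw [this, zero_mul]
    · rw [mul_zero]
  obtain ⟨c, hc, hcc₀⟩ := exists_disintegration hUV hPB hPY c₀
  have hcπ : ∀ v a, π a = 0 → (c v).out (marg Prod.fst π) a.1 a.2 = 0 := by
    intro v
    by_cases hv : marg Prod.snd PUV v = 0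
    · rw [hcc₀ v hv]
      exact hc₀π
    · exact hc.out_eq_zero_of_KL_ne_top hd' hv
  rw [hc.KL_eq hd']
  set S := ∑ v, marg Prod.snd PUV v * (c v).div (marg Prod.fst π) π with hS
  have hP := hUV.marg (Prod.snd : Fin m × Fin l → Fin l)
  have hslack := hc.sum_slack_eq (PW := PW) hUV hX
  let κ' : Option (Fin l) → TestChannel X Y B (Fin m) := fun o => o.elim c₀ c
  have hκ'π : ∀ o a, π a = 0 → (κ' o).out (marg Prod.fst π) a.1 a.2 = 0 := by
    rintro (_ | v)
    · exact hc₀π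
    · exact hcπ v
  obtain ⟨n, κ, hn, hμ, hD⟩ := exists_word
    (ω := fun o : Option (Fin l) => o.elim 0 (marg Prod.snd PUV))
    ⟨by rintro (_ | v); exacts [le_rfl, hP.1 v], by simpa [Fintype.sum_option] using hP.2⟩
    (μ := fun o => (κ' o).slack PW (marg Prod.fst π))
    (D := fun o => (κ' o).div (marg Prod.fst π) π)
    (by
      simp only [Fintype.sum_option, Option.elim, zero_mul, zero_add, κ']
      linarith)
    (v₀ := none) hc₀s (half_pos hε)
  simp only [Fintype.sum_option, Option.elim_none, Option.elim_some, zero_mul, zero_add, κ'] at hD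
  obtain ⟨N, hN, C, hC⟩ := exists_code_of_word hPW hX hπ (u₀ := u₀) (fun u => rfl) hc₀s hc₀π hn
    (κ := fun i => κ' (κ i)) hμ (fun i => hκ'π _) (half_pos hε)
  refine ⟨N, hN, C, ?_⟩
  have hN0 : (N : ℝ≥0∞) ≠ 0 := by simpa using (by omega : N ≠ 0)
  refine (ENNReal.div_le_iff hN0 (ENNReal.natCast_ne_top N)).2 (hC.trans ?_)
  calc _ ≤ ENNReal.ofReal ((S + ε) * N) := by
        rw [mul_comm]
        exact ENNReal.ofReal_le_ofReal (mul_le_mul_of_nonneg_right (by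
          simp only [κ']
          linarith) (Nat.cast_nonneg N))
    _ = ENNReal.ofReal (S + ε) * N := by
        rw [ENNReal.ofReal_mul' (Nat.cast_nonneg N), ENNReal.ofReal_natCast]
    _ ≤ _ := by
        gcongr
        exact ENNReal.ofReal_add_le

/-- There is a code of positive blocklength. -/
lemma SeqCode.nonempty_one [Nonempty X] [Nonempty B] [Nonempty Y] : Nonempty (SeqCode W X Y B 1) := by
  let c : TestChannel X Y B Unit := TestChannel.uniform () (Classical.arbitrary Y)
  exact ⟨⟨fun _ _ _ _ => c.pB () (Classical.arbitrary X),
    fun _ _ _ _ => c.pY () (Classical.arbitrary B),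
    fun _ _ _ _ => c.pB_dist _ _, fun _ _ _ _ => c.pY_dist _ _, fun _ _ _ _ _ _ _ _ _ _ => rfl,
    fun _ _ _ _ _ _ _ _ _ _ => rfl⟩⟩

end

/-- achievability: under the stated assumptions, for every `ε > 0`
there are `n ≥ 1` and a sequential code of blocklength `n` whose normalized
divergence is within `ε` of `Δ(π_{XY}, P_W)` (the least value of
`D(P_{Y|XV}‖π_{Y|X}|π_X P_V)` over all finite auxiliary alphabets and
distributions with `H(U|V) ≤ H(BU|XYV) + H(W)`). -/
theorem sequential_channel_synthesis_achievability
    (W X Y B : Type) [Fintype W] [Fintype X] [Fintype Y] [Fintype B]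
    (PW : W → ℝ) (hPW : IsDist PW)
    (π : X × Y → ℝ) (hπ : IsDist π)
    (hB : 2 ≤ Fintype.card B)
    (hy : ∃ y : Y, ∀ x : X, 0 < marg Prod.fst π x → 0 < π (x, y)) :
    ∀ ε : ℝ≥0∞, 0 < ε → ∃ (n : ℕ), 1 ≤ n ∧ ∃ C : SeqCode W X Y B n,
      KL
        (fun p : (Fin n → X) × (Fin n → Y) =>
          (∏ i, marg Prod.fst π (p.1 i)) * C.channel PW p.1 p.2)
        (fun p : (Fin n → X) × (Fin n → Y) => ∏ i, π (p.1 i, p.2 i)) / (n : ℝ≥0∞) ≤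
      sInf (psiSet X Y B π (ent PW)) + ε := by
  intro ε hε
  obtain ⟨y₀, hy₀⟩ := hy
  by_cases htop : sInf (psiSet X Y B π (ent PW)) + ε = ⊤
  · have : Nonempty B := Fintype.card_pos_iff.1 (by omega)
    have : Nonempty Y := ⟨y₀⟩
    have : Nonempty X := by
      by_contra hne
      rw [not_nonempty_iff] at hne
      simpa using hπ.2
    obtain ⟨C⟩ : Nonempty (SeqCode W X Y B 1) := SeqCode.nonempty_one
    exact ⟨1, le_rfl, C, by rw [htop]; exact le_top⟩
  obtain ⟨hI, hε'⟩ := ENNReal.add_ne_top.1 htop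
  have hε2 : ε / 2 ≠ 0 := (ENNReal.half_pos hε.ne').ne'
  have hε2' : ε / 2 ≠ ⊤ := ENNReal.div_ne_top hε' two_ne_zero
  obtain ⟨d, hd, hdlt⟩ := sInf_lt_iff.1 (ENNReal.lt_add_right hI hε2)
  obtain ⟨n, hn, C, hC⟩ := exists_code_of_mem_psiSet hPW hπ hB hy₀ hd hdlt.ne_top
    (ENNReal.toReal_pos hε2 hε2')
  refine ⟨n, hn, C, hC.trans ?_⟩
  rw [ENNReal.ofReal_toReal hε2']
  calc d + ε / 2 ≤ sInf (psiSet X Y B π (ent PW)) + ε / 2 + ε / 2 := by gcongr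
    _ = _ := by rw [add_assoc, ENNReal.add_halves]

end
end

section
/- Let 𝒳, 𝒴, 𝓑 be finite sets, π_X a distribution on 𝒳, and consider a restricted sequential code of blocklength n given by conditional distributions {(P_{B_k|X^k}, P_{Y_k|B^k Y^{k-1}})}_{k=1}^n, inducing a joint distribution on (X^n, B^n, Y^n) with X^n ∼ π_X^n. Then for every k ≤ n the joint marginal of (X^k, B_k, Y_k) factorizes as P_{X^k B_k Y_k}(x^k, b_k, y_k) = π_X^k(x^k) · P_{B_k|X^k}(b_k|x^k) · P_{Y_k|B_k X^{k-1}}(y_k|b_k, x^{k-1}); in particular, Y_k is conditionally independent of X_k given (B_k, X^{k-1}). -/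
open scoped BigOperators ENNReal
open Classical

noncomputable section

/-- A restricted sequential code of blocklength `n`: at epoch `k` the encoder
generates `B_k` from `X^k` only, and the decoder generates `Y_k` from
`(B^k, Y^{k-1})`; there is no common randomness. -/
structure RSeqCode (X Y B : Type) [Fintype X] [Fintype Y] [Fintype B] (n : ℕ) where
  enc : Fin n → (Fin n → X) → B → ℝ
  dec : Fin n → (Fin n → B) → (Fin n → Y) → Y → ℝ
  enc_dist : ∀ k x, IsDist (enc k x)
  dec_dist : ∀ k b y, IsDist (dec k b y)
  enc_causal : ∀ k x x', (∀ i, i ≤ k → x i = x' i) → enc k x = enc k x'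
  dec_causal : ∀ k b b' y y',
    (∀ i, i ≤ k → b i = b' i) → (∀ i, i < k → y i = y' i) → dec k b y = dec k b' y'

/-- The channel `P_{Y^n|X^n}` synthesized by a restricted sequential code. -/
def RSeqCode.channel {X Y B : Type} [Fintype X] [Fintype Y] [Fintype B] {n : ℕ}
    (C : RSeqCode X Y B n) (x : Fin n → X) (y : Fin n → Y) : ℝ :=
  ∑ b : Fin n → B, (∏ k, C.enc k x (b k)) * (∏ k, C.dec k b y (y k))

/-- The joint distribution of `(X^n, B^n, Y^n)` induced by a restricted sequential
code with `X^n ∼ π_X^n`. -/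
def RSeqCode.joint {X Y B : Type} [Fintype X] [Fintype Y] [Fintype B] {n : ℕ}
    (C : RSeqCode X Y B n) (πX : X → ℝ)
    (xv : Fin n → X) (bv : Fin n → B) (yv : Fin n → Y) : ℝ :=
  (∏ i, πX (xv i)) * (∏ i, C.enc i xv (bv i)) * (∏ i, C.dec i bv yv (yv i))

/-- Two functions have the same sum against a weight that ignores coordinate `j`, as soon as
their sums along coordinate `j` agree. -/
lemma sum_mul_congr_coord {ι Z : Type} [Fintype ι] [DecidableEq ι] [Fintype Z] (j : ι)
    (H g g' : (ι → Z) → ℝ) (hH : ∀ z a, H (Function.update z j a) = H z)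
    (hg : ∀ z, ∑ a, g (Function.update z j a) = ∑ a, g' (Function.update z j a)) :
    ∑ z, H z * g z = ∑ z, H z * g' z := by
  have key : ∀ f : (ι → Z) → ℝ, ∑ z, f z = ∑ u : {i // i ≠ j} → Z, ∑ a : Z,
      f ((Equiv.funSplitAt j Z).symm (a, u)) := fun f => by
    rw [← Fintype.sum_prod_type_right', ← Equiv.sum_comp (Equiv.funSplitAt j Z).symm]
  rw [key, key]
  refine Finset.sum_congr rfl fun u _ => ?_
  rcases isEmpty_or_nonempty Z with hZ | ⟨⟨a₀⟩⟩
  · simp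
  · set z := (Equiv.funSplitAt j Z).symm (a₀, u) with hz
    have hu : ∀ a, (Equiv.funSplitAt j Z).symm (a, u) = Function.update z j a := fun a => by
      ext i
      by_cases h : i = j
      · subst h; simp
      · simp [hz, h]
    simp only [hu, hH, ← Finset.mul_sum, hg]

/-- The expectation of a function of the first `k` coordinates of a sequential process does not
depend on the later kernels, which may be replaced by arbitrary independent ones. -/
lemma sum_mul_prod_kernel_truncate {n : ℕ} {Z : Type} [Fintype Z]
    (q : Fin n → (Fin n → Z) → Z → ℝ)
    (hq : ∀ i z z', (∀ j, j < i → z j = z' j) → q i z = q i z')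
    (hs : ∀ i z, ∑ a, q i z a = 1)
    (w : Fin n → Z → ℝ) (hw : ∀ i, ∑ a, w i a = 1)
    (k : ℕ) (F : (Fin n → Z) → ℝ)
    (hF : ∀ z z', (∀ i : Fin n, (i : ℕ) < k → z i = z' i) → F z = F z') :
    ∑ z, F z * ∏ i, q i z (z i) =
      ∑ z, F z * ∏ i : Fin n, if (i : ℕ) < k then q i z (z i) else w i (z i) := by
  have step : ∀ m, k ≤ m →
      (∑ z, F z * ∏ i : Fin n, if (i : ℕ) < m then q i z (z i) else w i (z i)) =
      ∑ z, F z * ∏ i : Fin n, if (i : ℕ) < m + 1 then q i z (z i) else w i (z i) := by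
    intro m hm
    by_cases hmn : m < n
    · let j : Fin n := ⟨m, hmn⟩
      have hne : ∀ i ∈ Finset.univ.erase j, (i : ℕ) < m + 1 ↔ (i : ℕ) < m := fun i hi => by
        have : (i : ℕ) ≠ m := fun h => (Finset.ne_of_mem_erase hi) (Fin.ext h)
        omega
      have hrest : ∀ z : Fin n → Z,
          (∏ i ∈ Finset.univ.erase j, if (i : ℕ) < m + 1 then q i z (z i) else w i (z i)) =
          ∏ i ∈ Finset.univ.erase j, if (i : ℕ) < m then q i z (z i) else w i (z i) :=
        fun z => Finset.prod_congr rfl fun i hi => by simp only [hne i hi]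
      have hl : ∀ z, (F z * ∏ i : Fin n, if (i : ℕ) < m then q i z (z i) else w i (z i)) =
          (F z * ∏ i ∈ Finset.univ.erase j, if (i : ℕ) < m then q i z (z i) else w i (z i)) *
            w j (z j) := fun z => by
        rw [← Finset.mul_prod_erase _ _ (Finset.mem_univ j), if_neg (lt_irrefl m)]; ring
      have hr : ∀ z, (F z * ∏ i : Fin n, if (i : ℕ) < m + 1 then q i z (z i) else w i (z i)) =
          (F z * ∏ i ∈ Finset.univ.erase j, if (i : ℕ) < m then q i z (z i) else w i (z i)) *
            q j z (z j) := fun z => by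
        rw [← Finset.mul_prod_erase _ _ (Finset.mem_univ j), if_pos (Nat.lt_succ_self m), hrest]
        ring
      rw [Finset.sum_congr rfl fun z _ => hl z, Finset.sum_congr rfl fun z _ => hr z]
      refine sum_mul_congr_coord j
        (fun z => F z * ∏ i ∈ Finset.univ.erase j,
          if (i : ℕ) < m then q i z (z i) else w i (z i))
        (fun z => w j (z j)) (fun z => q j z (z j)) (fun z a => ?_) (fun z => ?_)
      · refine congrArg₂ (· * ·) ?_ ?_
        · refine hF _ _ fun i hi => Function.update_of_ne ?_ _ _
          intro h; subst h; simp [j] at hi; omega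
        · refine Finset.prod_congr rfl fun i hi => ?_
          have hij := Finset.ne_of_mem_erase hi
          rw [Function.update_of_ne hij]
          split_ifs with him
          · have hz : ∀ l, l < i → Function.update z j a l = z l := fun l hl =>
              Function.update_of_ne (hl.trans him).ne _ _
            rw [hq i _ z hz]
          · rfl
      · have : ∀ a, q j (Function.update z j a) = q j z := fun a =>
          hq j _ _ fun l hl => Function.update_of_ne hl.ne _ _
        simp only [this, Function.update_self, hs, hw]
    · refine Finset.sum_congr rfl fun z _ => ?_
      congr 1
      refine Finset.prod_congr rfl fun i _ => ?_
      have : (i : ℕ) < m := by omega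
      simp [this, this.trans (Nat.lt_succ_self m)]
  have all : ∀ d, (∑ z, F z * ∏ i : Fin n, if (i : ℕ) < k then q i z (z i) else w i (z i)) =
      ∑ z, F z * ∏ i : Fin n, if (i : ℕ) < k + d then q i z (z i) else w i (z i) := by
    intro d
    induction d with
    | zero => rfl
    | succ d ih => rw [ih, step _ (Nat.le_add_right k d), Nat.add_assoc]
  rw [all n]
  refine Finset.sum_congr rfl fun z _ => ?_
  congr 1
  refine Finset.prod_congr rfl fun i _ => ?_
  rw [if_pos (by omega)]

lemma sum_prod_apply_eq_one {n : ℕ} {Z : Type} [Fintype Z] (w : Fin n → Z → ℝ)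
    (hw : ∀ i, ∑ a, w i a = 1) : ∑ z : Fin n → Z, ∏ i, w i (z i) = 1 := by
  rw [← Fintype.prod_sum]
  simp [hw]

namespace RSeqCode

variable {X Y B : Type} [Fintype X] [Fintype Y] [Fintype B] {n : ℕ}

/-- The expectation of `s (Y_k)` given `B^n = bv`. -/
def decExp (C : RSeqCode X Y B n) (k : Fin n) (s : Y → ℝ) (bv : Fin n → B) : ℝ :=
  ∑ yv : Fin n → Y, s (yv k) * ∏ i, C.dec i bv yv (yv i)

/-- The expectation of `s (Y_k)` given `X^{k-1}` and `B_k = b`. -/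
def condExp (C : RSeqCode X Y B n) (k : Fin n) (b : B) (s : Y → ℝ) (x : Fin n → X) : ℝ :=
  ∑ bv : Fin n → B, C.decExp k s bv *
    ∏ i, if i < k then C.enc i x (bv i) else if bv i = b then 1 else 0

lemma decExp_congr (C : RSeqCode X Y B n) (k : Fin n) (s : Y → ℝ) (y₀ : Y)
    (bv bv' : Fin n → B) (h : ∀ i, i ≤ k → bv i = bv' i) :
    C.decExp k s bv = C.decExp k s bv' := by
  have trunc : ∀ bv, C.decExp k s bv = ∑ yv : Fin n → Y, s (yv k) * ∏ i : Fin n,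
      if (i : ℕ) < k + 1 then C.dec i bv yv (yv i) else if yv i = y₀ then 1 else 0 := fun bv =>
    sum_mul_prod_kernel_truncate (fun i => C.dec i bv)
      (fun i z z' hz => C.dec_causal i bv bv z z' (fun _ _ => rfl) hz)
      (fun i z => (C.dec_dist i bv z).2) (fun _ a => if a = y₀ then 1 else 0) (by simp)
      (k + 1) (fun yv => s (yv k)) (fun z z' hz => by rw [hz k (Nat.lt_succ_self _)])
  rw [trunc, trunc]
  refine Finset.sum_congr rfl fun yv _ => ?_
  congr 1
  refine Finset.prod_congr rfl fun i _ => ?_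
  split_ifs with hi
  · rw [C.dec_causal i bv bv' yv yv (fun j hj => h j (hj.trans ?_)) (fun _ _ => rfl)]
    rw [Fin.le_def]; omega
  all_goals rfl

lemma decExp_one (C : RSeqCode X Y B n) (k : Fin n) (y₀ : Y) (bv : Fin n → B) :
    C.decExp k (fun _ => 1) bv = 1 := by
  rw [decExp, sum_mul_prod_kernel_truncate (fun i => C.dec i bv)
    (fun i z z' hz => C.dec_causal i bv bv z z' (fun _ _ => rfl) hz)
    (fun i z => (C.dec_dist i bv z).2) (fun _ a => if a = y₀ then 1 else 0) (by simp)
    0 (fun _ => 1) (fun _ _ _ => rfl)]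
  simp only [Nat.not_lt_zero, if_false, one_mul]
  exact sum_prod_apply_eq_one (fun _ a => if a = y₀ then 1 else 0) (by simp)

lemma condExp_one (C : RSeqCode X Y B n) (k : Fin n) (b : B) (y₀ : Y) (x : Fin n → X) :
    C.condExp k b (fun _ => 1) x = 1 := by
  simp only [condExp, C.decExp_one k y₀, one_mul]
  refine sum_prod_apply_eq_one
    (fun i a => if i < k then C.enc i x a else if a = b then 1 else 0) fun i => ?_
  by_cases h : i < k
  · simpa [h] using (C.enc_dist i x).2
  · simp [h]

lemma condExp_congr (C : RSeqCode X Y B n) (k : Fin n) (b : B) (s : Y → ℝ)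
    (x x' : Fin n → X) (h : ∀ i, i < k → x i = x' i) :
    C.condExp k b s x = C.condExp k b s x' := by
  refine Finset.sum_congr rfl fun bv _ => ?_
  congr 1
  refine Finset.prod_congr rfl fun i _ => ?_
  split_ifs with hi
  · rw [C.enc_causal i x x' fun j hj => h j (hj.trans_lt hi)]
  all_goals rfl

/-- The joint law of `(X^n, B_k, Y_k)`, tested against `s` in the last coordinate. -/
lemma sum_joint (C : RSeqCode X Y B n) (πX : X → ℝ) (k : Fin n) (b : B) (s : Y → ℝ) (y₀ : Y)
    (x : Fin n → X) :
    ∑ bv : Fin n → B, ∑ yv : Fin n → Y,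
      (if bv k = b then s (yv k) * C.joint πX x bv yv else 0) =
    (∏ i, πX (x i)) * C.enc k x b * C.condExp k b s x := by
  have h1 : ∀ bv : Fin n → B,
      ∑ yv : Fin n → Y, (if bv k = b then s (yv k) * C.joint πX x bv yv else 0) =
      (∏ i, πX (x i)) * (((if bv k = b then 1 else 0) * C.decExp k s bv) *
        ∏ i, C.enc i x (bv i)) := fun bv => by
    split_ifs
    · rw [decExp, one_mul, Finset.sum_mul, Finset.mul_sum]
      refine Finset.sum_congr rfl fun yv _ => ?_
      rw [joint]; ring
    · simp
  simp only [h1]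
  rw [← Finset.mul_sum, mul_assoc]
  congr 1
  rw [sum_mul_prod_kernel_truncate (fun i _ => C.enc i x) (fun _ _ _ _ => rfl)
    (fun i _ => (C.enc_dist i x).2) (fun _ a => if a = b then 1 else 0) (by simp)
    (k + 1) (fun bv => (if bv k = b then 1 else 0) * C.decExp k s bv)
    (fun z z' hz => by
      rw [hz k (Nat.lt_succ_self _), C.decExp_congr k s y₀ z z' fun i hi => hz i ?_]
      exact Nat.lt_succ_of_le hi)]
  rw [condExp, Finset.mul_sum]
  refine Finset.sum_congr rfl fun bv _ => ?_
  rw [← Finset.mul_prod_erase _ _ (Finset.mem_univ k),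
    ← Finset.mul_prod_erase _ _ (Finset.mem_univ k)]
  have hrest : (∏ i ∈ Finset.univ.erase k,
        if (i : ℕ) < k + 1 then C.enc i x (bv i) else if bv i = b then 1 else 0) =
      ∏ i ∈ Finset.univ.erase k,
        if i < k then C.enc i x (bv i) else if bv i = b then 1 else 0 := by
    refine Finset.prod_congr rfl fun i hi => ?_
    have hik : (i : ℕ) ≠ k := fun h => (Finset.ne_of_mem_erase hi) (Fin.ext h)
    have : (i : ℕ) < k + 1 ↔ i < k := by rw [Fin.lt_def]; omega
    simp only [this]
  rw [hrest]
  by_cases hb : bv k = b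
  · simp [hb]; ring
  · simp [hb]

end RSeqCode

/-- The marginal of a product distribution on an initial segment of coordinates. -/
lemma sum_prod_eq_prod_filter {n : ℕ} {X : Type} [Fintype X] (π : X → ℝ) (hπ : ∑ a, π a = 1)
    (k : Fin n) (xs : Fin n → X) :
    (∑ x : Fin n → X, if ∀ i, i ≤ k → x i = xs i then ∏ i, π (x i) else 0) =
      ∏ i ∈ Finset.univ.filter (fun i : Fin n => i ≤ k), π (xs i) := by
  have h := sum_mul_prod_kernel_truncate (fun (_ : Fin n) _ => π) (fun _ _ _ _ => rfl)
    (fun _ _ => hπ) (fun i a => if a = xs i then 1 else 0) (by simp) (k + 1)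
    (fun x => if ∀ i, i ≤ k → x i = xs i then 1 else 0) (fun z z' hz => by
      have : ∀ i, i ≤ k → z i = z' i := fun i hi => hz i (Nat.lt_succ_of_le hi)
      have : (∀ i, i ≤ k → z i = xs i) ↔ ∀ i, i ≤ k → z' i = xs i :=
        forall₂_congr fun i hi => by rw [this i hi]
      simp only [this])
  simp only [ite_mul, one_mul, zero_mul] at h
  rw [h, Finset.sum_eq_single xs, if_pos fun _ _ => rfl, Finset.prod_filter]
  · refine Finset.prod_congr rfl fun i _ => ?_
    simp only [Fin.le_def, Nat.lt_succ_iff, if_true]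
  · intro x _ hx
    obtain ⟨i, hi⟩ := Function.ne_iff.1 hx
    split_ifs with hE
    · refine Finset.prod_eq_zero (Finset.mem_univ i) ?_
      rw [if_neg fun hik => hi (hE i (Nat.lt_succ_iff.1 hik)), if_neg hi]
    · rfl
  · simp

/-- under the joint distribution induced by a restricted sequential
code, the marginal of `(X^k, B_k, Y_k)` factorizes as
`π_X^k(x^k) · P_{B_k|X^k}(b_k|x^k) · P_{Y_k|B_k X^{k-1}}(y_k|b_k, x^{k-1})`;
in particular `Y_k ⊥ X_k | (B_k, X^{k-1})`.  Here the conditional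
`P_{Y_k|B_k X^{k-1}}` is the quotient of the induced marginals (with the
convention `r/0 = 0`). -/
theorem restricted_sequential_markov_factorization
    (X Y B : Type) [Fintype X] [Fintype Y] [Fintype B]
    (πX : X → ℝ) (hπX : IsDist πX)
    (n : ℕ) (C : RSeqCode X Y B n)
    (k : Fin n) (xs : Fin n → X) (b : B) (y : Y) :
    (∑ xv : Fin n → X, ∑ bv : Fin n → B, ∑ yv : Fin n → Y,
        if (∀ i, i ≤ k → xv i = xs i) ∧ bv k = b ∧ yv k = y then
          C.joint πX xv bv yv else 0) =
      (∏ i ∈ Finset.univ.filter (fun i : Fin n => i ≤ k), πX (xs i)) *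
      C.enc k xs b *
      ((∑ xv : Fin n → X, ∑ bv : Fin n → B, ∑ yv : Fin n → Y,
          if (∀ i, i < k → xv i = xs i) ∧ bv k = b ∧ yv k = y then
            C.joint πX xv bv yv else 0) /
       (∑ xv : Fin n → X, ∑ bv : Fin n → B, ∑ yv : Fin n → Y,
          if (∀ i, i < k → xv i = xs i) ∧ bv k = b then
            C.joint πX xv bv yv else 0)) := by
  have hsum : ∀ (P : (Fin n → X) → Prop) [DecidablePred P] (s : Y → ℝ),
      (∀ x, P x → C.condExp k b s x = C.condExp k b s xs) →
      (∑ xv : Fin n → X, ∑ bv : Fin n → B, ∑ yv : Fin n → Y,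
        if P xv ∧ bv k = b then s (yv k) * C.joint πX xv bv yv else 0) =
      (∑ xv : Fin n → X, if P xv then (∏ i, πX (xv i)) * C.enc k xv b else 0) *
        C.condExp k b s xs := fun P _ s hP => by
    rw [Finset.sum_mul]
    refine Finset.sum_congr rfl fun x _ => ?_
    by_cases hx : P x
    · simp only [hx, true_and, if_true]
      rw [C.sum_joint πX k b s y, hP x hx]
    · simp [hx]
  have hind : ∀ (P : (Fin n → X) → Prop) [DecidablePred P],
      (∑ xv : Fin n → X, ∑ bv : Fin n → B, ∑ yv : Fin n → Y,
        if P xv ∧ bv k = b ∧ yv k = y then C.joint πX xv bv yv else 0) =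
      ∑ xv : Fin n → X, ∑ bv : Fin n → B, ∑ yv : Fin n → Y,
        if P xv ∧ bv k = b then (if yv k = y then 1 else 0) * C.joint πX xv bv yv else 0 :=
    fun P _ => by simp only [ite_mul, one_mul, zero_mul, ← ite_and, and_assoc]
  have hone := hsum (fun x => ∀ i, i < k → x i = xs i) (fun _ => 1)
    fun x hx => C.condExp_congr k b _ x xs hx
  simp only [one_mul, C.condExp_one k b y, mul_one] at hone
  rw [hind (fun x => ∀ i, i ≤ k → x i = xs i), hind (fun x => ∀ i, i < k → x i = xs i), hone,
    hsum (fun x => ∀ i, i ≤ k → x i = xs i) (fun a => if a = y then 1 else 0)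
      fun x hx => C.condExp_congr k b _ x xs fun i hi => hx i hi.le,
    hsum (fun x => ∀ i, i < k → x i = xs i) (fun a => if a = y then 1 else 0)
      fun x hx => C.condExp_congr k b _ x xs hx]
  have hpast : (∑ xv : Fin n → X, if ∀ i, i ≤ k → xv i = xs i then
        (∏ i, πX (xv i)) * C.enc k xv b else 0) =
      (∏ i ∈ Finset.univ.filter (fun i : Fin n => i ≤ k), πX (xs i)) * C.enc k xs b := by
    rw [← sum_prod_eq_prod_filter πX hπX.2, Finset.sum_mul]
    refine Finset.sum_congr rfl fun x _ => ?_
    split_ifs with hx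
    · rw [C.enc_causal k x xs hx]
    · simp
  have hnonneg : ∀ x : Fin n → X, 0 ≤ (∏ i, πX (x i)) * C.enc k x b := fun x =>
    mul_nonneg (Finset.prod_nonneg fun i _ => hπX.1 _) ((C.enc_dist k x).1 b)
  have hle : (∑ xv : Fin n → X, if ∀ i, i ≤ k → xv i = xs i then
        (∏ i, πX (xv i)) * C.enc k xv b else 0) ≤
      ∑ xv : Fin n → X, if ∀ i, i < k → xv i = xs i then
        (∏ i, πX (xv i)) * C.enc k xv b else 0 := by
    refine Finset.sum_le_sum fun x _ => ?_
    by_cases hx : ∀ i, i ≤ k → x i = xs i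
    · rw [if_pos hx, if_pos fun i hi => hx i hi.le]
    · rw [if_neg hx]
      split_ifs
      exacts [hnonneg x, le_rfl]
  have hpos : 0 ≤ ∑ xv : Fin n → X, if ∀ i, i ≤ k → xv i = xs i then
        (∏ i, πX (xv i)) * C.enc k xv b else 0 :=
    Finset.sum_nonneg fun x _ => by
      split_ifs
      exacts [hnonneg x, le_rfl]
  rw [← hpast]
  by_cases hE : (∑ xv : Fin n → X, if ∀ i, i < k → xv i = xs i then
      (∏ i, πX (xv i)) * C.enc k xv b else 0) = 0
  · rw [le_antisymm (hle.trans hE.le) hpos]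
    simp
  · rw [mul_div_cancel_left₀ _ hE]

end
end
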